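/- arXiv:math/0508487 — 2 statements merged into one kernel-verified Lean document; each statement's English description precedes it below -/
import Mathlib

section
/- Let r > 0, K > 0, and y ∈ ℝ satisfy e^y ≤ K m, where m = ∫_0^∞ r e^{−r t} E[e^{X̲_t}] dt. For x ∈ ℝ set σ_x = inf{t ≥ 0 : x + X_t < y} and v_y(x) = E[e^{−r σ_x} (K − e^{x + X_{σ_x}})^+ 1_{{σ_x < ∞}}]. Then for every x ∈ ℝ, the process t ↦ e^{−r t} v_y(x + X_t) is a supermartingale with respect to (F_t)_{t ≥ 0}. -/
open MeasureTheory ProbabilityTheory Set Filter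
open scoped ENNReal NNReal Classical

noncomputable section

namespace AKLevy

variable {Ω : Type*}

/-- Running supremum `X̄_t = sup_{0 ≤ s ≤ t} X_s` of a process. -/
def runSup (X : ℝ → Ω → ℝ) (t : ℝ) (ω : Ω) : ℝ :=
  sSup ((fun s => X s ω) '' Set.Icc 0 t)

/-- Running infimum `X̲_t = inf_{0 ≤ s ≤ t} X_s` of a process. -/
def runInf (X : ℝ → Ω → ℝ) (t : ℝ) (ω : Ω) : ℝ :=
  sInf ((fun s => X s ω) '' Set.Icc 0 t)

/-- All-time supremum `X̄_∞ = sup_{t ≥ 0} X_t`. -/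
def supAll (X : ℝ → Ω → ℝ) (ω : Ω) : ℝ :=
  sSup ((fun s => X s ω) '' Set.Ici 0)

/-- All-time infimum `X̲_∞ = inf_{t ≥ 0} X_t`. -/
def infAll (X : ℝ → Ω → ℝ) (ω : Ω) : ℝ :=
  sInf ((fun s => X s ω) '' Set.Ici 0)

/-- `X` is a real-valued Lévy process with respect to the filtration `ℱ`,
on a filtered probability space satisfying the usual conditions. -/
structure IsLevy [m0 : MeasurableSpace Ω] (P : Measure Ω) (ℱ : Filtration ℝ m0)
    (X : ℝ → Ω → ℝ) : Prop where
  isProb : IsProbabilityMeasure P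
  adapted : ∀ t : ℝ, 0 ≤ t → StronglyMeasurable[ℱ t] (X t)
  zero : ∀ᵐ ω ∂P, X 0 ω = 0
  rightCont : ∀ ω, ∀ t : ℝ, 0 ≤ t → ContinuousWithinAt (fun s => X s ω) (Set.Ici t) t
  leftLim : ∀ ω, ∀ t : ℝ, 0 < t →
    ∃ l : ℝ, Tendsto (fun s => X s ω) (nhdsWithin t (Set.Iio t)) (nhds l)
  indepIncrements : ∀ s t : ℝ, 0 ≤ s → s ≤ t →
    Indep (MeasurableSpace.comap (fun ω => X t ω - X s ω) inferInstance) (ℱ s) P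
  stationary : ∀ s t : ℝ, 0 ≤ s → s ≤ t →
    Measure.map (fun ω => X t ω - X s ω) P = Measure.map (X (t - s)) P
  filtRightCont : ∀ t : ℝ, (ℱ t : MeasurableSpace Ω) = ⨅ s ∈ Set.Ioi t, (ℱ s : MeasurableSpace Ω)
  complete : ∀ N : Set Ω, MeasurableSet N → P N = 0 → MeasurableSet[ℱ 0] N

/-- `τ_x^+ < ∞`: the process passes strictly above level `x` at some nonnegative time. -/
def hitsAbove (X : ℝ → Ω → ℝ) (x : ℝ) (ω : Ω) : Prop := ∃ t, 0 ≤ t ∧ x < X t ω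

/-- First passage time above `x`:  `τ_x^+ = inf {t ≥ 0 : X_t > x}` (junk value if never). -/
def tauAbove (X : ℝ → Ω → ℝ) (x : ℝ) (ω : Ω) : ℝ := sInf {t : ℝ | 0 ≤ t ∧ x < X t ω}

/-- `τ_x^- < ∞`: the process passes strictly below level `x` at some nonnegative time. -/
def hitsBelow (X : ℝ → Ω → ℝ) (x : ℝ) (ω : Ω) : Prop := ∃ t, 0 ≤ t ∧ X t ω < x

/-- First passage time below `x`:  `τ_x^- = inf {t ≥ 0 : X_t < x}` (junk value if never). -/
def tauBelow (X : ℝ → Ω → ℝ) (x : ℝ) (ω : Ω) : ℝ := sInf {t : ℝ | 0 ≤ t ∧ X t ω < x}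

/-- The `[0,∞]`-valued first passage time `σ_x = inf { t ≥ 0 : x + X_t < y }`, with `inf ∅ = ∞`. -/
def hitBelowE (X : ℝ → Ω → ℝ) (y x : ℝ) (ω : Ω) : ℝ≥0∞ :=
  if ∃ t, 0 ≤ t ∧ x + X t ω < y then ENNReal.ofReal (sInf {t : ℝ | 0 ≤ t ∧ x + X t ω < y})
  else ∞

/-- The stopped clock `t ∧ σ_x` (real-valued), where `σ_x = inf{ t ≥ 0 : x + X_t < y}`. -/
def stoppedClock (X : ℝ → Ω → ℝ) (y x : ℝ) (t : ℝ) (ω : Ω) : ℝ :=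
  (min (ENNReal.ofReal t) (hitBelowE X y x ω)).toReal

/-- A `[0,∞]`-valued stopping time of the filtration `ℱ`. -/
def IsStopTime [m0 : MeasurableSpace Ω] (ℱ : Filtration ℝ m0) (τ : Ω → ℝ≥0∞) : Prop :=
  ∀ t : ℝ, 0 ≤ t → MeasurableSet[ℱ t] {ω | τ ω ≤ ENNReal.ofReal t}

/-- Discounted payoff `e^{-rτ} G(x + X_τ)` at a `[0,∞]`-valued time `τ`, set to `0` on `{τ = ∞}`. -/
def stopPayoff (X : ℝ → Ω → ℝ) (r x : ℝ) (G : ℝ → ℝ) (τ : Ω → ℝ≥0∞) (ω : Ω) : ℝ :=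
  if τ ω ≠ ∞ then Real.exp (-(r * (τ ω).toReal)) * G (x + X ((τ ω).toReal) ω) else 0

/-- Discounted American put payoff `e^{-rτ}(K - e^{x + X_τ})^+ 1_{τ < ∞}`. -/
def putPayoff (X : ℝ → Ω → ℝ) (r K x : ℝ) (τ : Ω → ℝ≥0∞) (ω : Ω) : ℝ :=
  stopPayoff X r x (fun z => max (K - Real.exp z) 0) τ ω

/-- Value function `v(x) = sup_τ E[e^{-rτ}(K - e^{x+X_τ})^+ 1_{τ<∞}]`, the supremum
being over all `[0,∞]`-valued stopping times of `ℱ`. -/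
def putValue [m0 : MeasurableSpace Ω] (P : Measure Ω) (ℱ : Filtration ℝ m0)
    (X : ℝ → Ω → ℝ) (r K x : ℝ) : ℝ :=
  ⨆ τ : {τ : Ω → ℝ≥0∞ // IsStopTime ℱ τ}, ∫ ω, putPayoff X r K x τ.1 ω ∂P

/-- `m = E[e^{X̲_{e_r}}]`, where `e_r` is an independent exponential time of rate `r > 0`,
and `e_0 = ∞`. -/
def mInf [m0 : MeasurableSpace Ω] (P : Measure Ω) (X : ℝ → Ω → ℝ) (r : ℝ) : ℝ :=
  if 0 < r then
    ∫ t in Set.Ioi (0 : ℝ), r * Real.exp (-(r * t)) * (∫ ω, Real.exp (runInf X t ω) ∂P)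
  else ∫ ω, Real.exp (infAll X ω) ∂P

/-- `P(X̲_{e_r} = 0)`, where `e_r` is an independent exponential time of rate `r > 0`,
and `e_0 = ∞`. -/
def atomZeroProb [m0 : MeasurableSpace Ω] (P : Measure Ω) (X : ℝ → Ω → ℝ) (r : ℝ) : ℝ :=
  if 0 < r then
    ∫ t in Set.Ioi (0 : ℝ), r * Real.exp (-(r * t)) * (P {ω | runInf X t ω = 0}).toReal
  else (P {ω | infAll X ω = 0}).toReal

/-- The event `{τ_0^- = 0}`: `0` is (pathwise) immediately reached from below, i.e.
`inf{t ≥ 0 : X_t < 0} = 0`. -/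
def regularBelow (X : ℝ → Ω → ℝ) : Set Ω :=
  {ω | ∀ ε > (0 : ℝ), ∃ t, 0 ≤ t ∧ t < ε ∧ X t ω < 0}

/-- `E[e^{-γ X̄_{e_α}}] = ∫_0^∞ α e^{-α t} E[e^{-γ X̄_t}] dt`. -/
def expSupLT [m0 : MeasurableSpace Ω] (P : Measure Ω) (X : ℝ → Ω → ℝ) (α γ : ℝ) : ℝ :=
  ∫ t in Set.Ioi (0 : ℝ), α * Real.exp (-(α * t)) * (∫ ω, Real.exp (-(γ * runSup X t ω)) ∂P)

/-- The function `h_{α,β}(x) = E[e^{-α σ_x + β (x + X_{σ_x})} 1_{σ_x < ∞}]`, where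
`σ_x = inf{t ≥ 0 : x + X_t < 0}`. -/
def hAB [m0 : MeasurableSpace Ω] (P : Measure Ω) (X : ℝ → Ω → ℝ) (α β : ℝ) (z : ℝ) : ℝ :=
  ∫ ω, (if hitsBelow X (-z) ω then
      Real.exp (-(α * tauBelow X (-z) ω) + β * (z + X (tauBelow X (-z) ω) ω)) else 0) ∂P

/-- `v_y(x) = E[e^{-r σ_x} (K - e^{x + X_{σ_x}})^+ 1_{σ_x<∞}]` where
`σ_x = inf{t ≥ 0 : x + X_t < y}`. -/
def vy [m0 : MeasurableSpace Ω] (P : Measure Ω) (X : ℝ → Ω → ℝ) (r K y : ℝ) (z : ℝ) : ℝ :=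
  ∫ ω, putPayoff X r K z (hitBelowE X y z) ω ∂P

/-- The process `f` (indexed by `t ≥ 0`) is a martingale with respect to `ℱ` and `P`. -/
def MartOn [m0 : MeasurableSpace Ω] (P : Measure Ω) (ℱ : Filtration ℝ m0)
    (f : ℝ → Ω → ℝ) : Prop :=
  (∀ t : ℝ, 0 ≤ t → StronglyMeasurable[ℱ t] (f t)) ∧
  (∀ t : ℝ, 0 ≤ t → Integrable (f t) P) ∧
  ∀ s t : ℝ, 0 ≤ s → s ≤ t → P[f t|ℱ s] =ᵐ[P] f s

/-- The process `f` (indexed by `t ≥ 0`) is a supermartingale w.r.t. `ℱ` and `P`. -/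
def SupermartOn [m0 : MeasurableSpace Ω] (P : Measure Ω) (ℱ : Filtration ℝ m0)
    (f : ℝ → Ω → ℝ) : Prop :=
  (∀ t : ℝ, 0 ≤ t → StronglyMeasurable[ℱ t] (f t)) ∧
  (∀ t : ℝ, 0 ≤ t → Integrable (f t) P) ∧
  ∀ s t : ℝ, 0 ≤ s → s ≤ t → P[f t|ℱ s] ≤ᵐ[P] f s

open Topology

/-- The infimum of a path over the window `[a, a + |u|]`. -/
def winInf (p : ℝ → ℝ) (a u : ℝ) : ℝ := sInf (p '' Icc a (a + |u|))

/-- A path that is right-continuous and bounded below on every compact interval. -/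
structure RegularPath (p : ℝ → ℝ) : Prop where
  rightCont : ∀ t, ContinuousWithinAt p (Ici t) t
  bddBelow : ∀ a b, BddBelow (p '' Icc a b)

namespace RegularPath

variable {p : ℝ → ℝ}

lemma left_mem_window (a u : ℝ) : a ∈ Icc a (a + |u|) := ⟨le_rfl, by simp⟩

lemma right_mem_window (a u : ℝ) : a + |u| ∈ Icc a (a + |u|) := ⟨by simp, le_rfl⟩

lemma winInf_lt_iff (hp : RegularPath p) {a u c : ℝ} :
    winInf p a u < c ↔ ∃ v ∈ Icc a (a + |u|), p v < c := by
  rw [winInf, csInf_lt_iff (hp.bddBelow _ _) (Set.Nonempty.image _ ⟨a, left_mem_window a u⟩)]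
  simp only [exists_mem_image]

lemma winInf_le (hp : RegularPath p) {a u v : ℝ} (hv : v ∈ Icc a (a + |u|)) :
    winInf p a u ≤ p v :=
  csInf_le (hp.bddBelow _ _) (mem_image_of_mem _ hv)

lemma le_winInf {a u c : ℝ} (h : ∀ v ∈ Icc a (a + |u|), c ≤ p v) : c ≤ winInf p a u :=
  le_csInf (Set.Nonempty.image _ ⟨a, left_mem_window a u⟩) 
    (by rintro _ ⟨v, hv, rfl⟩; exact h v hv)

lemma winInf_anti (hp : RegularPath p) {a u a' u' : ℝ}
    (h : Icc a (a + |u|) ⊆ Icc a' (a' + |u'|)) : winInf p a' u' ≤ winInf p a u :=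
  le_winInf fun _ hv => hp.winInf_le (h hv)

/-- If a right-continuous path is below `c` at time `t`, it stays so just after `t`. -/
lemma exists_forall_lt (hp : RegularPath p) {t c : ℝ} (h : p t < c) :
    ∃ t' > t, ∀ v ∈ Ico t t', p v < c := by
  have := (hp.rightCont t).eventually_lt_const h
  obtain ⟨t', ht', hs⟩ := mem_nhdsGE_iff_exists_Ico_subset.1 this
  exact ⟨t', ht', fun v hv => hs hv⟩

lemma exists_forall_gt (hp : RegularPath p) {t c : ℝ} (h : c < p t) :
    ∃ t' > t, ∀ v ∈ Ico t t', c < p v := by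
  have := (hp.rightCont t).eventually_const_lt h
  obtain ⟨t', ht', hs⟩ := mem_nhdsGE_iff_exists_Ico_subset.1 this
  exact ⟨t', ht', fun v hv => hs hv⟩

lemma exists_Icc_lt_iff (hp : RegularPath p) {a b c : ℝ} (hab : a ≤ b) :
    (∃ v ∈ Icc a b, p v < c) ↔ (∃ q : ℚ, (q : ℝ) ∈ Icc a b ∧ p q < c) ∨ p b < c := by
  constructor
  · rintro ⟨v, hv, hvc⟩
    rcases hv.2.eq_or_lt with rfl | hlt
    · exact Or.inr hvc
    obtain ⟨t', ht', h⟩ := hp.exists_forall_lt hvc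
    obtain ⟨q, hq1, hq2⟩ := exists_rat_btwn (lt_min hlt ht')
    exact Or.inl ⟨q, ⟨hv.1.trans hq1.le, (hq2.trans_le (min_le_left _ _)).le⟩,
      h q ⟨hq1.le, hq2.trans_le (min_le_right _ _)⟩⟩
  · rintro (⟨q, hq, h⟩ | h)
    · exact ⟨q, hq, h⟩
    · exact ⟨b, ⟨hab, le_rfl⟩, h⟩

lemma exists_Ico_lt_iff (hp : RegularPath p) {a b c : ℝ} :
    (∃ v, a ≤ v ∧ v < b ∧ p v < c) ↔ ∃ q : ℚ, a ≤ (q : ℝ) ∧ (q : ℝ) < b ∧ p q < c := by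
  constructor
  · rintro ⟨v, hav, hvb, hvc⟩
    obtain ⟨t', ht', h⟩ := hp.exists_forall_lt hvc
    obtain ⟨q, hq1, hq2⟩ := exists_rat_btwn (lt_min hvb ht')
    exact ⟨q, hav.trans hq1.le, hq2.trans_le (min_le_left _ _),
      h q ⟨hq1.le, hq2.trans_le (min_le_right _ _)⟩⟩
  · rintro ⟨q, h⟩
    exact ⟨q, h⟩

/-- The dyadic points of `[a, a + |u|]` detect whether a right-continuous path goes below `c`. -/
lemma exists_window_lt_iff (hp : RegularPath p) {a u c : ℝ} :
    (∃ v ∈ Icc a (a + |u|), p v < c) ↔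
      ∃ n : ℕ, ∃ k ≤ 2 ^ n, p (a + (k : ℕ) * (|u| / 2 ^ n)) < c := by
  constructor
  · rintro ⟨v, hv, hvc⟩
    rcases hv.2.eq_or_lt with rfl | hlt
    · exact ⟨0, 1, by simp, by simpa using hvc⟩
    have hu : 0 < |u| := by linarith [hv.1]
    obtain ⟨t', ht', h⟩ := hp.exists_forall_lt hvc
    obtain ⟨n, hn⟩ := exists_nat_gt (|u| / (min t' (a + |u|) - v))
    have hd : 0 < min t' (a + |u|) - v := sub_pos.2 (lt_min ht' hlt)
    have hn2 : |u| / 2 ^ n < min t' (a + |u|) - v := by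
      rw [div_lt_iff₀ hd] at hn
      rw [div_lt_iff₀ (by positivity)]
      have : (n : ℝ) < 2 ^ n := by exact_mod_cast Nat.lt_two_pow_self
      nlinarith
    have hstep : 0 < |u| / 2 ^ n := by positivity
    set k := ⌈(v - a) / (|u| / 2 ^ n)⌉₊ with hk
    have h1 : (v - a) / (|u| / 2 ^ n) ≤ k := Nat.le_ceil _
    have h2 : (k : ℝ) < (v - a) / (|u| / 2 ^ n) + 1 :=
      Nat.ceil_lt_add_one (div_nonneg (by linarith [hv.1]) hstep.le)
    rw [div_le_iff₀ hstep] at h1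
    rw [div_add_one hstep.ne', lt_div_iff₀ hstep] at h2
    have h3 : a + k * (|u| / 2 ^ n) < min t' (a + |u|) := by linarith
    refine ⟨n, k, ?_, h _ ⟨by linarith, h3.trans_le (min_le_left _ _)⟩⟩
    have h4 : (k : ℝ) * (|u| / 2 ^ n) < |u| := by
      linarith [h3.trans_le (min_le_right _ _)]
    have h5 : (k : ℝ) < 2 ^ n := by
      rw [mul_div_assoc', div_lt_iff₀ (by positivity), mul_comm] at h4
      exact lt_of_mul_lt_mul_left h4 hu.le
    exact_mod_cast h5.le
  · rintro ⟨n, k, hk, h⟩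
    refine ⟨_, ⟨?_, ?_⟩, h⟩
    · have : 0 ≤ (k : ℝ) * (|u| / 2 ^ n) := by positivity
      linarith
    · have hk' : (k : ℝ) ≤ 2 ^ n := by exact_mod_cast hk
      have : (k : ℝ) * (|u| / 2 ^ n) ≤ 2 ^ n * (|u| / 2 ^ n) := by gcongr
      rw [mul_div_cancel₀ _ (by positivity)] at this
      linarith

lemma tendsto_winInf (hp : RegularPath p) {a u : ℝ} {s : ℕ → ℝ} (hs : ∀ n, a ≤ s n)
    (hlim : Tendsto s atTop (𝓝 a)) :
    Tendsto (fun n => winInf p (s n) u) atTop (𝓝 (winInf p a u)) := by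
  refine tendsto_order.2 ⟨fun c hc => ?_, fun c hc => ?_⟩
  · obtain ⟨c', hc, hc'⟩ := exists_between hc
    obtain ⟨t', ht', h⟩ := hp.exists_forall_gt (hc'.trans_le (hp.winInf_le (right_mem_window a u)))
    filter_upwards [hlim.eventually_lt_const (show a < t' - |u| by linarith)] with n hn
    refine hc.trans_le (le_winInf fun v hv => ?_)
    rcases le_total v (a + |u|) with hva | hva
    · exact hc'.le.trans (hp.winInf_le ⟨(hs n).trans hv.1, hva⟩)
    · exact (h v ⟨hva, by linarith [hv.2]⟩).le
  · obtain ⟨v, hv, hvc⟩ := hp.winInf_lt_iff.1 hc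
    rcases hv.1.eq_or_lt with rfl | hlt
    · obtain ⟨t', ht', h⟩ := hp.exists_forall_lt hvc
      filter_upwards [hlim.eventually_lt_const ht'] with n hn
      exact hp.winInf_lt_iff.2 ⟨s n, left_mem_window _ _, h _ ⟨hs n, hn⟩⟩
    · filter_upwards [hlim.eventually_lt_const hlt] with n hn
      exact hp.winInf_lt_iff.2 ⟨v, ⟨hn.le, by linarith [hs n, hv.2]⟩, hvc⟩

/-- At the first passage time below `c`, a right-continuous path is at most `c`. -/
lemma apply_sInf_le (hp : RegularPath p) {c : ℝ} (h : ∃ t, 0 ≤ t ∧ p t < c) :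
    p (sInf {t | 0 ≤ t ∧ p t < c}) ≤ c := by
  by_contra! hc
  obtain ⟨t', ht', hgt⟩ := hp.exists_forall_gt hc
  obtain ⟨v, hv, hvt⟩ := (csInf_lt_iff ⟨0, fun x hx => hx.1⟩ h).1 ht'
  exact absurd hv.2 (hgt v ⟨csInf_le ⟨0, fun x hx => hx.1⟩ hv, hvt⟩).not_gt

/-- After the first passage time below `c`, the window infimum may be started at that time. -/
lemma winInf_zero_eq (hp : RegularPath p) {c τ u : ℝ} (h : ∃ t, 0 ≤ t ∧ p t < c)
    (hτ : τ = sInf {t | 0 ≤ t ∧ p t < c}) (hu : 0 < u) :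
    winInf p 0 (τ + u) = winInf p τ u ∧ winInf p 0 (τ + u) < c := by
  have hbd : BddBelow {t | 0 ≤ t ∧ p t < c} := ⟨0, fun x hx => hx.1⟩
  have h0 : 0 ≤ τ := hτ ▸ le_csInf h fun x hx => hx.1
  have e1 : |τ + u| = τ + u := abs_of_nonneg (by linarith)
  have e2 : |u| = u := abs_of_pos hu
  obtain ⟨v, hv, hvt⟩ := (csInf_lt_iff hbd h).1 (show sInf _ < τ + u by rw [← hτ]; linarith)
  have hle : τ ≤ v := hτ ▸ csInf_le hbd hv
  have hlt : winInf p τ u < c := hp.winInf_lt_iff.2 ⟨v, ⟨hle, by rw [e2]; exact hvt.le⟩, hv.2⟩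
  have heq : winInf p 0 (τ + u) = winInf p τ u := by
    refine le_antisymm (hp.winInf_anti ?_) (le_winInf fun w hw => ?_)
    · rw [e1, e2, zero_add]; exact Icc_subset_Icc_left h0
    · rw [e1, zero_add] at hw
      rcases le_or_gt τ w with hτw | hτw
      · exact hp.winInf_le ⟨hτw, by rw [e2]; exact hw.2⟩
      · refine hlt.le.trans (le_of_not_gt fun hwc => hτw.not_ge ?_)
        rw [hτ]
        exact csInf_le hbd ⟨hw.1, hwc⟩
  exact ⟨heq, heq ▸ hlt⟩

/-- Before the first passage time below `c`, the window infimum is at least `c`. -/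
lemma le_winInf_zero {c u : ℝ} (hu : 0 ≤ u)
    (h : u < sInf {t | 0 ≤ t ∧ p t < c} ∨ ¬ ∃ t, 0 ≤ t ∧ p t < c) : c ≤ winInf p 0 u := by
  refine le_winInf fun v hv => le_of_not_gt fun hvc => ?_
  rw [zero_add, abs_of_nonneg hu] at hv
  rcases h with h | h
  · exact absurd (csInf_le ⟨0, fun x hx => hx.1⟩ (show v ∈ {t | 0 ≤ t ∧ p t < c} from ⟨hv.1, hvc⟩))
      (not_le.2 (hv.2.trans_lt h))
  · exact h ⟨v, hv.1, hvc⟩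

end RegularPath

/-- Right-continuity together with left limits on the half-line makes a path regular. -/
lemma regularPath_of_cadlag {p : ℝ → ℝ} (hr : ∀ t, 0 ≤ t → ContinuousWithinAt p (Ici t) t)
    (hl : ∀ t, 0 < t → ∃ l, Tendsto p (𝓝[<] t) (𝓝 l)) :
    RegularPath fun t => p (max t 0) := by
  have hrc : ∀ t, ContinuousWithinAt (fun t => p (max t 0)) (Ici t) t := fun t =>
    (hr (max t 0) (le_max_right _ _)).comp (f := fun t => max t 0) (s := Ici t)
      (by fun_prop) fun v hv =>
      mem_Ici.2 (max_le_max_right 0 (mem_Ici.1 hv))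
  refine ⟨hrc, fun a b => ?_⟩
  refine (isCompact_Icc (a := a) (b := b)).induction_on
    (p := fun s => BddBelow ((fun t => p (max t 0)) '' s)) (by simp)
    (fun s t hst h => h.mono (image_mono hst)) (fun s t hs ht => ?_) fun t _ => ?_
  · rw [image_union]; exact hs.union ht
  · have hR : ∃ c, ∀ᶠ v in 𝓝[≥] t, c < p (max v 0) :=
      ⟨_, (hrc t).eventually_const_lt (sub_one_lt _)⟩
    have hL : ∃ c, ∀ᶠ v in 𝓝[<] t, c < p (max v 0) := by
      rcases le_or_gt t 0 with h0 | h0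
      · refine ⟨p 0 - 1, ?_⟩
        filter_upwards [self_mem_nhdsWithin] with v hv
        rw [max_eq_right (le_of_lt (lt_of_lt_of_le hv h0))]
        exact sub_one_lt _
      · obtain ⟨l, h⟩ := hl t h0
        refine ⟨l - 1, ?_⟩
        filter_upwards [h.eventually_const_lt (sub_one_lt l),
          mem_nhdsWithin_of_mem_nhds (lt_mem_nhds h0)] with v hv hv0
        rwa [max_eq_left (le_of_lt hv0)]
    obtain ⟨c, hR⟩ := hR
    obtain ⟨c', hL⟩ := hL
    have : ∀ᶠ v in 𝓝 t, min c c' < p (max v 0) := by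
      rw [← nhdsLT_sup_nhdsGE, eventually_sup]
      exact ⟨hL.mono fun v hv => (min_le_right _ _).trans_lt hv,
        hR.mono fun v hv => (min_le_left _ _).trans_lt hv⟩
    refine ⟨_, mem_nhdsWithin_of_mem_nhds this, min c c', ?_⟩
    rintro _ ⟨v, hv, rfl⟩
    exact le_of_lt hv

/-- If `D` has law `ν` independently of the σ-algebra `m`, then on every event of `m` the joint
law of an `m`-measurable variable and `D` is a product. -/
lemma map_restrict_prodMk {m m0 : MeasurableSpace Ω} {P : Measure Ω} [IsFiniteMeasure P]
    (hm : m ≤ m0) {ν : Measure ℝ} [IsFiniteMeasure ν] {D : Ω → ℝ} (hDm : Measurable D)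
    (hD : ∀ A, MeasurableSet[m] A → ∀ T, MeasurableSet T → P (A ∩ D ⁻¹' T) = P A * ν T)
    {A : Set Ω} (hA : MeasurableSet[m] A) {Z : Ω → ℝ} (hZ : Measurable[m] Z) :
    (P.restrict A).map (fun ω => (Z ω, D ω)) = ((P.restrict A).map Z).prod ν := by
  have hZ' : Measurable Z := hZ.mono hm le_rfl
  refine (Measure.prod_eq fun S T hS hT => ?_).symm
  rw [Measure.map_apply (hZ'.prodMk hDm) (hS.prod hT), Measure.map_apply hZ' hS,
    Measure.restrict_apply ((hZ'.prodMk hDm) (hS.prod hT)), Measure.restrict_apply (hZ' hS),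
    ← hD _ ((hZ hS).inter hA) T hT]
  congr 1
  ext ω
  simp only [mem_inter_iff, mem_preimage, mem_prod]
  tauto

/-- The law of a random walk with step law `ν` started at `0`, killed when it is below `c`. -/
def killedWalkLaw (ν : Measure ℝ) (c : ℝ) : ℕ → Measure ℝ
  | 0 => (Measure.dirac 0).restrict (Ici c)
  | n + 1 => (((killedWalkLaw ν c n).prod ν).map fun p => p.1 + p.2).restrict (Ici c)

instance (ν : Measure ℝ) [IsFiniteMeasure ν] (c : ℝ) (n : ℕ) :
    IsFiniteMeasure (killedWalkLaw ν c n) := by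
  induction n with
  | zero => rw [killedWalkLaw]; infer_instance
  | succ n ih => rw [killedWalkLaw]; infer_instance

/-- A process with regular paths on the whole line whose increments over nonnegative times are
stationary and independent of the past. -/
structure RegularLevy [m0 : MeasurableSpace Ω] (P : Measure Ω) (ℱ : Filtration ℝ m0)
    (Y : ℝ → Ω → ℝ) : Prop where
  isProb : IsProbabilityMeasure P
  path : ∀ ω, RegularPath fun t => Y t ω
  measurable : ∀ t, Measurable (Y t)
  adapted : ∀ t, 0 ≤ t → Measurable[ℱ t] (Y t)
  zero : ∀ᵐ ω ∂P, Y 0 ω = 0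
  increment : ∀ s h, 0 ≤ s → 0 ≤ h → ∀ A, MeasurableSet[ℱ s] A → ∀ T, MeasurableSet T →
    P (A ∩ (fun ω => Y (s + h) ω - Y s ω) ⁻¹' T) = P A * P.map (Y h) T

/-- The drop `inf_{a ≤ v ≤ a + |u|} Y_v - Y_a`. -/
def windowDrop (Y : ℝ → Ω → ℝ) (a u : ℝ) (ω : Ω) : ℝ :=
  winInf (fun t => Y t ω) a u - Y a ω

/-- Rounding up to the next multiple of `1 / (n + 1)`. -/
def roundUp (n : ℕ) (t : ℝ) : ℝ := (⌊(n + 1) * t⌋ + 1 : ℤ) / (n + 1 : ℝ)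

lemma lt_roundUp (n : ℕ) (t : ℝ) : t < roundUp n t := by
  rw [roundUp, lt_div_iff₀ (by positivity), mul_comm]
  push_cast
  exact Int.lt_floor_add_one _

lemma tendsto_roundUp (t : ℝ) : Tendsto (fun n => roundUp n t) atTop (𝓝 t) := by
  have h : Tendsto (fun n : ℕ => t + 1 / ((n : ℝ) + 1)) atTop (𝓝 (t + 0)) :=
    tendsto_const_nhds.add tendsto_one_div_add_atTop_nhds_zero_nat
  rw [add_zero] at h
  refine tendsto_of_tendsto_of_tendsto_of_le_of_le tendsto_const_nhds h
    (fun n => (lt_roundUp n t).le) fun n => ?_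
  have hn : (0 : ℝ) < n + 1 := by positivity
  have := Int.floor_le (((n : ℝ) + 1) * t)
  rw [roundUp, div_le_iff₀ hn]
  push_cast
  field_simp
  linarith

lemma tendsto_roundUp_nhdsGE (t : ℝ) : Tendsto (fun n => roundUp n t) atTop (𝓝[≥] t) :=
  tendsto_nhdsWithin_iff.2 ⟨tendsto_roundUp t, .of_forall fun n => (lt_roundUp n t).le⟩

namespace RegularLevy

variable [m0 : MeasurableSpace Ω] {P : Measure Ω} {ℱ : Filtration ℝ m0} {Y : ℝ → Ω → ℝ}

lemma measurable_uncurry (hY : RegularLevy P ℱ Y) :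
    Measurable fun x : ℝ × Ω => Y x.1 x.2 := by
  refine measurable_of_tendsto_metrizable (f := fun (n : ℕ) (x : ℝ × Ω) => Y (roundUp n x.1) x.2)
    (fun n => ?_) (tendsto_pi_nhds.2 fun x => ?_)
  · have h : Measurable fun x : ℤ × Ω => Y ((x.1 + 1 : ℤ) / (n + 1 : ℝ)) x.2 :=
      measurable_from_prod_countable_right fun k =>
        hY.measurable ((k + 1 : ℤ) / (n + 1 : ℝ))
    exact h.comp (Measurable.prodMk (Int.measurable_floor.comp (by fun_prop)) measurable_snd)
  · exact ((hY.path x.2).rightCont x.1).tendsto.comp (tendsto_roundUp_nhdsGE x.1)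

lemma measurable_winInf (hY : RegularLevy P ℱ Y) :
    Measurable fun x : ℝ × ℝ × Ω => winInf (fun t => Y t x.2.2) x.1 x.2.1 := by
  refine measurable_of_Iio fun c => ?_
  have : (fun x : ℝ × ℝ × Ω => winInf (fun t => Y t x.2.2) x.1 x.2.1) ⁻¹' Iio c =
      (⋃ q : ℚ, ({x | x.1 ≤ (q : ℝ)} ∩ {x | (q : ℝ) ≤ x.1 + |x.2.1|}) ∩ {x | Y q x.2.2 < c}) ∪
        {x | Y (x.1 + |x.2.1|) x.2.2 < c} := by
    ext x
    simp only [mem_preimage, mem_Iio, (hY.path x.2.2).winInf_lt_iff]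
    rw [(hY.path x.2.2).exists_Icc_lt_iff (by simp)]
    simp only [mem_union, mem_iUnion, mem_inter_iff, mem_ofPred_eq, mem_Icc]
  rw [this]
  refine MeasurableSet.union (.iUnion fun q => ?_) ?_
  · refine ((measurableSet_le (by fun_prop) (by fun_prop)).inter
      (measurableSet_le (by fun_prop) ?_)).inter (measurableSet_lt ?_ (by fun_prop))
    · exact measurable_fst.add measurable_snd.fst.abs
    · exact (hY.measurable q).comp (by fun_prop)
  · refine measurableSet_lt ?_ (by fun_prop)
    exact hY.measurable_uncurry.comp
      (Measurable.prodMk (measurable_fst.add measurable_snd.fst.abs) measurable_snd.snd)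

lemma measurable_windowDrop (hY : RegularLevy P ℱ Y) :
    Measurable fun x : ℝ × ℝ × Ω => windowDrop Y x.1 x.2.1 x.2.2 :=
  hY.measurable_winInf.sub
    (hY.measurable_uncurry.comp (measurable_fst.prodMk measurable_snd.snd))

lemma measurable_windowDrop_apply (hY : RegularLevy P ℱ Y) (a u : ℝ) :
    Measurable (windowDrop Y a u) := by
  have h : Measurable fun ω : Ω => (u, ω) := measurable_prodMk_left
  have h' : Measurable fun x : ℝ × Ω => (a, x) := measurable_prodMk_left
  have := hY.measurable_windowDrop.comp (h'.comp h)
  exact this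

lemma windowDrop_nonpos (hY : RegularLevy P ℱ Y) (a u : ℝ) (ω : Ω) : windowDrop Y a u ω ≤ 0 :=
  sub_nonpos.2 ((hY.path ω).winInf_le (RegularPath.left_mem_window a u))

lemma map_restrict_grid (hY : RegularLevy P ℱ Y) {a h : ℝ} (ha : 0 ≤ a) (hh : 0 ≤ h) (c : ℝ)
    {A : Set Ω} (hA : MeasurableSet[ℱ a] A) (n : ℕ) :
    (P.restrict ({ω | ∀ k ≤ n, c ≤ Y (a + (k : ℕ) * h) ω - Y a ω} ∩ A)).map
      (fun ω => Y (a + n * h) ω - Y a ω) = P A • killedWalkLaw (P.map (Y h)) c n := by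
  have := hY.isProb
  have hsplit : ∀ n : ℕ, {ω | ∀ k ≤ n + 1, c ≤ Y (a + (k : ℕ) * h) ω - Y a ω} =
      (fun ω => Y (a + (n + 1 : ℕ) * h) ω - Y a ω) ⁻¹' Ici c ∩
        {ω | ∀ k ≤ n, c ≤ Y (a + (k : ℕ) * h) ω - Y a ω} := by
    intro n
    ext ω
    simp only [mem_ofPred_eq, mem_inter_iff, mem_preimage, mem_Ici, Nat.le_succ_iff]
    constructor
    · exact fun H => ⟨H _ (Or.inr rfl), fun k hk => H k (Or.inl hk)⟩
    · rintro ⟨H1, H2⟩ k (hk | rfl)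
      exacts [H2 k hk, H1]
  have hSm : ∀ k : ℕ, Measurable fun ω => Y (a + k * h) ω - Y a ω := fun k =>
    (hY.measurable _).sub (hY.measurable _)
  have hadapt : ∀ k n : ℕ, k ≤ n →
      Measurable[ℱ (a + n * h)] fun ω => Y (a + k * h) ω - Y a ω := by
    intro k n hkn
    have h1 : a + k * h ≤ a + n * h := by gcongr
    have h2 : a ≤ a + n * h := by simp; positivity
    exact Measurable.sub ((hY.adapted _ (by positivity)).mono (ℱ.mono h1) le_rfl)
      ((hY.adapted _ ha).mono (ℱ.mono h2) le_rfl)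
  have hG : ∀ n : ℕ, MeasurableSet[ℱ (a + n * h)]
      {ω | ∀ k ≤ n, c ≤ Y (a + (k : ℕ) * h) ω - Y a ω} := by
    intro n
    simp only [ofPred_forall]
    exact MeasurableSet.iInter fun k => MeasurableSet.iInter fun hk =>
      (hadapt k n hk) measurableSet_Ici
  induction n with
  | zero =>
    have : {ω | ∀ k ≤ 0, c ≤ Y (a + (k : ℕ) * h) ω - Y a ω} =
        (fun _ : Ω => (0 : ℝ)) ⁻¹' Ici c := by
      ext ω; simp
    rw [this, ← Measure.restrict_restrict (measurable_const measurableSet_Ici)]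
    simp only [Nat.cast_zero, zero_mul, add_zero, sub_self]
    rw [← Measure.restrict_map measurable_const measurableSet_Ici, Measure.map_const,
      killedWalkLaw, Measure.restrict_smul, Measure.restrict_apply_univ]
  | succ n ih =>
    have hmA : MeasurableSet A := ℱ.le a _ hA
    have hAn : MeasurableSet[ℱ (a + n * h)] A :=
      ℱ.mono (show a ≤ a + n * h by simp; positivity) _ hA
    have hstep : (fun ω => Y (a + (n + 1 : ℕ) * h) ω - Y a ω) =
        (fun p : ℝ × ℝ => p.1 + p.2) ∘ fun ω =>
          (Y (a + n * h) ω - Y a ω, Y (a + n * h + h) ω - Y (a + n * h) ω) := by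
      ext ω
      have : a + ((n + 1 : ℕ) : ℝ) * h = a + n * h + h := by push_cast; ring
      simp only [Function.comp, this]
      ring
    have hDm : Measurable fun ω => Y (a + n * h + h) ω - Y (a + n * h) ω :=
      (hY.measurable _).sub (hY.measurable _)
    have : IsProbabilityMeasure (P.map (Y h)) :=
      Measure.isProbabilityMeasure_map (hY.measurable h).aemeasurable
    rw [hsplit, inter_assoc, ← Measure.restrict_restrict ((hSm _) measurableSet_Ici),
      ← Measure.restrict_map (hSm _) measurableSet_Ici, hstep,
      ← Measure.map_map (by fun_prop) ((hSm n).prodMk hDm),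
      map_restrict_prodMk (ℱ.le _) hDm
        (hY.increment _ _ (by positivity) hh) ((hG n).inter hAn) (hadapt n n le_rfl), ih,
      killedWalkLaw, Measure.prod_smul_left, Measure.map_smul, Measure.restrict_smul]

lemma measure_inter_grid (hY : RegularLevy P ℱ Y) {a h : ℝ} (ha : 0 ≤ a) (hh : 0 ≤ h) (c : ℝ)
    {A : Set Ω} (hA : MeasurableSet[ℱ a] A) (n : ℕ) :
    P ({ω | ∀ k ≤ n, c ≤ Y (a + (k : ℕ) * h) ω - Y a ω} ∩ A) =
      P A * P {ω | ∀ k ≤ n, c ≤ Y (0 + (k : ℕ) * h) ω - Y 0 ω} := by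
  have := hY.isProb
  have key : ∀ {a : ℝ} (_ : 0 ≤ a) {A : Set Ω} (_ : MeasurableSet[ℱ a] A),
      P ({ω | ∀ k ≤ n, c ≤ Y (a + (k : ℕ) * h) ω - Y a ω} ∩ A) =
        P A * killedWalkLaw (P.map (Y h)) c n univ := by
    intro a ha A hA
    have := congrArg (fun μ : Measure ℝ => μ univ) (hY.map_restrict_grid ha hh c hA n)
    have hm : Measurable fun ω => Y (a + n * h) ω - Y a ω :=
      (hY.measurable _).sub (hY.measurable _)
    rwa [Measure.map_apply hm .univ, preimage_univ, Measure.restrict_apply_univ] at this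
  have h0 := key le_rfl (A := univ) MeasurableSet.univ
  rw [measure_univ, one_mul, inter_univ] at h0
  rw [key ha hA, h0]

lemma measure_inter_windowDrop_ge (hY : RegularLevy P ℱ Y) {a : ℝ} (ha : 0 ≤ a) (u c : ℝ)
    {A : Set Ω} (hA : MeasurableSet[ℱ a] A) :
    P (A ∩ windowDrop Y a u ⁻¹' Ici c) = P A * P (windowDrop Y 0 u ⁻¹' Ici c) := by
  have := hY.isProb
  set G : ℝ → ℕ → Set Ω := fun a n =>
    {ω | ∀ k ≤ 2 ^ n, c ≤ Y (a + (k : ℕ) * (|u| / 2 ^ n)) ω - Y a ω} with hG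
  have hGm : ∀ a n, MeasurableSet (G a n) := by
    intro a n
    simp only [hG, ofPred_forall]
    exact MeasurableSet.iInter fun k => MeasurableSet.iInter fun _ =>
      ((hY.measurable _).sub (hY.measurable _)) measurableSet_Ici
  have hanti : ∀ a, Antitone (G a) := by
    intro a
    refine antitone_nat_of_succ_le fun n ω hω k hk => ?_
    have := hω (2 * k) (by rw [pow_succ]; omega)
    convert this using 4
    push_cast
    rw [pow_succ]
    field_simp
  have hInter : ∀ a, windowDrop Y a u ⁻¹' Ici c = ⋂ n, G a n := by
    intro a
    ext ω
    simp only [mem_preimage, mem_Ici, mem_iInter, windowDrop, hG, mem_ofPred_eq, le_sub_iff_add_le]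
    rw [← not_lt, (hY.path ω).winInf_lt_iff, (hY.path ω).exists_window_lt_iff]
    push Not
    rfl
  have h1 := tendsto_measure_iInter_atTop (μ := P)
    (fun n => ((hGm a n).inter (ℱ.le a _ hA)).nullMeasurableSet)
    (fun i j hij => inter_subset_inter_left A (hanti a hij)) ⟨0, measure_ne_top _ _⟩
  have h2 := tendsto_measure_iInter_atTop (μ := P)
    (fun n => (hGm 0 n).nullMeasurableSet) (hanti 0) ⟨0, measure_ne_top _ _⟩
  rw [← iInter_inter, ← hInter, inter_comm] at h1
  rw [← hInter] at h2
  have h3 := ENNReal.Tendsto.const_mul h2 (Or.inr (measure_ne_top P A))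
  refine tendsto_nhds_unique h1 (h3.congr fun n => ?_)
  exact (hY.measure_inter_grid ha (by positivity) c hA (2 ^ n)).symm

/-- Markov property: the drop of the path after time `a` is independent of the past. -/
lemma measure_inter_windowDrop (hY : RegularLevy P ℱ Y) {a : ℝ} (ha : 0 ≤ a) (u : ℝ)
    {A : Set Ω} (hA : MeasurableSet[ℱ a] A) {T : Set ℝ} (hT : MeasurableSet T) :
    P (A ∩ windowDrop Y a u ⁻¹' T) = P A * P.map (windowDrop Y 0 u) T := by
  have := hY.isProb
  have hm : ∀ a, Measurable (windowDrop Y a u) := fun a => hY.measurable_windowDrop_apply a u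
  have : (P.restrict A).map (windowDrop Y a u) = P A • P.map (windowDrop Y 0 u) := by
    refine Measure.ext_of_Ici _ _ fun c => ?_
    rw [Measure.map_apply (hm a) measurableSet_Ici,
      Measure.restrict_apply ((hm a) measurableSet_Ici), inter_comm,
      hY.measure_inter_windowDrop_ge ha u c hA, Measure.smul_apply,
      Measure.map_apply (hm 0) measurableSet_Ici, smul_eq_mul]
  have := congrArg (fun μ : Measure ℝ => μ T) this
  simp only [Measure.smul_apply, smul_eq_mul] at this
  rw [← this, Measure.map_apply (hm a) hT, Measure.restrict_apply ((hm a) hT), inter_comm]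

lemma setIntegral_markov (hY : RegularLevy P ℱ Y) {a : ℝ} (ha : 0 ≤ a) (u : ℝ)
    {A : Set Ω} (hA : MeasurableSet[ℱ a] A) {f : ℝ × ℝ → ℝ} (hf : Measurable f) {C : ℝ}
    (hC : ∀ x, |f x| ≤ C) :
    ∫ ω in A, f (Y a ω, windowDrop Y a u ω) ∂P =
      ∫ ω in A, ∫ ω', f (Y a ω, windowDrop Y 0 u ω') ∂P ∂P := by
  have := hY.isProb
  have hm : ∀ a, Measurable (windowDrop Y a u) := fun a => hY.measurable_windowDrop_apply a u
  have : IsProbabilityMeasure (P.map (windowDrop Y 0 u)) :=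
    Measure.isProbabilityMeasure_map (hm 0).aemeasurable
  have hprod := map_restrict_prodMk (ℱ.le a) (hm a)
    (fun A hA T hT => hY.measure_inter_windowDrop ha u hA hT) hA (hY.adapted a ha)
  have hint : Integrable f
      (((P.restrict A).map (Y a)).prod (P.map (windowDrop Y 0 u))) :=
    Integrable.of_bound hf.aestronglyMeasurable C (.of_forall fun x => hC x)
  rw [← integral_map (φ := fun ω => (Y a ω, windowDrop Y a u ω))
    ((hY.measurable a).prodMk (hm a)).aemeasurable hf.aestronglyMeasurable, hprod,
    integral_prod _ hint, integral_map (hY.measurable a).aemeasurable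
      hf.stronglyMeasurable.integral_prod_right'.aestronglyMeasurable]
  refine integral_congr_ae (.of_forall fun ω => ?_)
  exact integral_map (hm 0).aemeasurable (hf.comp measurable_prodMk_left).aestronglyMeasurable

end RegularLevy

lemma IsLevy.regularLevy [m0 : MeasurableSpace Ω] {P : Measure Ω} {ℱ : Filtration ℝ m0}
    {X : ℝ → Ω → ℝ} (hX : IsLevy P ℱ X) : RegularLevy P ℱ fun t => X (max t 0) where
  isProb := hX.isProb
  path ω := regularPath_of_cadlag (hX.rightCont ω) (hX.leftLim ω)
  measurable t := ((hX.adapted _ (le_max_right t 0)).measurable).mono (ℱ.le _) le_rfl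
  adapted t ht := by
    rw [max_eq_left ht]
    exact (hX.adapted t ht).measurable
  zero := by simpa using hX.zero
  increment s h hs hh A hA T hT := by
    have := hX.isProb
    have hsh : 0 ≤ s + h := by positivity
    have hm : ∀ t, 0 ≤ t → Measurable (X t) := fun t ht =>
      (hX.adapted t ht).measurable.mono (ℱ.le t) le_rfl
    simp only [max_eq_left hs, max_eq_left hh, max_eq_left hsh]
    have h1 := hX.stationary s (s + h) hs (by linarith)
    rw [add_sub_cancel_left] at h1
    have hD : Measurable fun ω => X (s + h) ω - X s ω := (hm _ hsh).sub (hm _ hs)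
    rw [← h1, Measure.map_apply hD hT, inter_comm, mul_comm]
    exact Indep_iff _ _ _ |>.1 (hX.indepIncrements s (s + h) hs (by linarith)) _ _
      ⟨T, hT, rfl⟩ hA

lemma measurable_roundUp (n : ℕ) : Measurable (roundUp n) := by
  have h : Measurable fun t : ℝ => ⌊((n : ℝ) + 1) * t⌋ :=
    Int.measurable_floor.comp (measurable_id.const_mul _)
  exact (measurable_from_top (f := fun k : ℤ => ((k + 1 : ℤ) : ℝ) / (n + 1 : ℝ))).comp h

namespace RegularLevy

variable [m0 : MeasurableSpace Ω] {P : Measure Ω} {ℱ : Filtration ℝ m0} {Y : ℝ → Ω → ℝ}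

lemma measurable_stopped (hY : RegularLevy P ℱ Y) {T : Ω → ℝ} (hT : Measurable T) :
    Measurable fun ω => Y (T ω) ω :=
  hY.measurable_uncurry.comp (hT.prodMk measurable_id)

lemma measurable_windowDrop_stopped (hY : RegularLevy P ℱ Y) {T : Ω → ℝ} (hT : Measurable T)
    (u : ℝ) : Measurable fun ω => windowDrop Y (T ω) u ω := by
  have h : Measurable fun ω : Ω => (u, ω) := measurable_prodMk_left
  have := hY.measurable_windowDrop.comp (hT.prodMk h)
  exact this

lemma abs_mul_exp_windowDrop_le (hY : RegularLevy P ℱ Y) {b C : ℝ} (hb : |b| ≤ C)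
    (a u : ℝ) (ω : Ω) : |b * Real.exp (windowDrop Y a u ω)| ≤ C := by
  rw [abs_mul, Real.abs_exp]
  have : Real.exp (windowDrop Y a u ω) ≤ 1 := Real.exp_le_one_iff.2 (hY.windowDrop_nonpos a u ω)
  exact (mul_le_of_le_one_right (abs_nonneg _) this).trans hb

lemma setIntegral_roundUp (hY : RegularLevy P ℱ Y) {T : Ω → ℝ} {H : Set Ω} (hT : Measurable T)
    (h0 : ∀ ω ∈ H, 0 ≤ T ω) (hopt : ∀ q, 0 ≤ q → MeasurableSet[ℱ q] (H ∩ {ω | T ω < q}))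
    (u : ℝ) {ψ : ℝ × ℝ → ℝ} (hψ : Continuous ψ) {C : ℝ} (hC : ∀ x, |ψ x| ≤ C) (n : ℕ) :
    ∫ ω in H, ψ (roundUp n (T ω), Y (roundUp n (T ω)) ω) *
        Real.exp (windowDrop Y (roundUp n (T ω)) u ω) ∂P =
      (∫ ω in H, ψ (roundUp n (T ω), Y (roundUp n (T ω)) ω) ∂P) *
        ∫ ω, Real.exp (windowDrop Y 0 u ω) ∂P := by
  have := hY.isProb
  have hn : (0 : ℝ) < n + 1 := by positivity
  have hRm : Measurable fun ω => roundUp n (T ω) := (measurable_roundUp n).comp hT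
  set A : ℕ → Set Ω := fun k => H ∩ {ω | ⌊((n : ℝ) + 1) * T ω⌋ = k} with hA
  set q : ℕ → ℝ := fun k => ((k : ℤ) + 1 : ℤ) / (n + 1 : ℝ) with hq
  have hq0 : ∀ k, 0 ≤ q k := fun k => div_nonneg (by push_cast; positivity) hn.le
  have hAq : ∀ k, MeasurableSet[ℱ (q k)] (A k) := by
    intro k
    have hle : (k : ℝ) / (n + 1) ≤ q k := by
      simp only [hq]; push_cast; gcongr; linarith
    have : A k = (H ∩ {ω | T ω < q k}) \ (H ∩ {ω | T ω < (k : ℝ) / (n + 1)}) := by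
      ext ω
      simp only [hA, hq, mem_inter_iff, mem_ofPred_eq, Set.mem_sdiff, Int.floor_eq_iff,
        lt_div_iff₀ hn,
        mul_comm (T ω)]
      push_cast
      rw [← not_le (a := (k : ℝ))]
      tauto
    rw [this]
    exact (hopt _ (hq0 k)).diff (ℱ.mono hle _ (hopt _ (by positivity)))
  have hAm : ∀ k, MeasurableSet (A k) := fun k => ℱ.le _ _ (hAq k)
  have hdisj : Pairwise (Function.onFun Disjoint A) := by
    intro i j hij
    refine disjoint_left.2 fun ω h1 h2 => hij ?_
    exact_mod_cast h1.2.symm.trans h2.2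
  have hU : H = ⋃ k, A k := by
    ext ω
    simp only [hA, mem_iUnion, mem_inter_iff, mem_ofPred_eq, exists_and_left, iff_self_and]
    intro hω
    exact ⟨_, (Int.toNat_of_nonneg (Int.floor_nonneg.2 (mul_nonneg hn.le (h0 ω hω)))).symm⟩
  have hround : ∀ k, ∀ ω ∈ A k, roundUp n (T ω) = q k := by
    intro k ω hω
    simp only [roundUp, hq, show ⌊((n : ℝ) + 1) * T ω⌋ = k from hω.2]
  have hint1 : Integrable (fun ω => ψ (roundUp n (T ω), Y (roundUp n (T ω)) ω)) P :=
    Integrable.of_bound (hψ.measurable.comp (hRm.prodMk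
      (hY.measurable_stopped hRm))).aestronglyMeasurable C (.of_forall fun ω => hC _)
  have hint2 : Integrable (fun ω => ψ (roundUp n (T ω), Y (roundUp n (T ω)) ω) *
      Real.exp (windowDrop Y (roundUp n (T ω)) u ω)) P :=
    Integrable.of_bound ((hψ.measurable.comp (hRm.prodMk
      (hY.measurable_stopped hRm))).mul (hY.measurable_windowDrop_stopped hRm u).exp
      ).aestronglyMeasurable C (.of_forall fun ω => hY.abs_mul_exp_windowDrop_le (hC _) _ _ _)
  rw [hU, integral_iUnion hAm hdisj hint1.integrableOn,
    integral_iUnion hAm hdisj hint2.integrableOn, ← tsum_mul_right]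
  refine tsum_congr fun k => ?_
  have e1 : ∫ ω in A k, ψ (roundUp n (T ω), Y (roundUp n (T ω)) ω) *
      Real.exp (windowDrop Y (roundUp n (T ω)) u ω) ∂P =
      ∫ ω in A k, ψ (q k, Y (q k) ω) * Real.exp (windowDrop Y (q k) u ω) ∂P :=
    setIntegral_congr_fun (hAm k) fun ω hω => by simp only [hround k ω hω]
  have e2 : ∫ ω in A k, ψ (roundUp n (T ω), Y (roundUp n (T ω)) ω) ∂P =
      ∫ ω in A k, ψ (q k, Y (q k) ω) ∂P :=
    setIntegral_congr_fun (hAm k) fun ω hω => by simp only [hround k ω hω]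
  rw [e1, e2, ← integral_mul_const]
  have := hY.setIntegral_markov (hq0 k) u (hAq k)
    (f := fun x => ψ (q k, x.1) * min (Real.exp x.2) 1) (C := C)
    (by have := hψ.measurable; fun_prop) fun x => by
      rw [abs_mul, abs_of_pos (lt_min (Real.exp_pos _) one_pos)]
      exact (mul_le_of_le_one_right (abs_nonneg _) (min_le_right _ _)).trans (hC _)
  have hmin : ∀ a ω, min (Real.exp (windowDrop Y a u ω)) 1 = Real.exp (windowDrop Y a u ω) :=
    fun a ω => min_eq_left (Real.exp_le_one_iff.2 (hY.windowDrop_nonpos a u ω))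
  simpa only [hmin, integral_const_mul] using this

/-- Strong Markov property at an optional time, for the drop of the path after that time. -/
lemma setIntegral_strongMarkov (hY : RegularLevy P ℱ Y) {T : Ω → ℝ} {H : Set Ω}
    (hT : Measurable T) (h0 : ∀ ω ∈ H, 0 ≤ T ω)
    (hopt : ∀ q, 0 ≤ q → MeasurableSet[ℱ q] (H ∩ {ω | T ω < q}))
    (u : ℝ) {ψ : ℝ × ℝ → ℝ} (hψ : Continuous ψ) {C : ℝ} (hC : ∀ x, |ψ x| ≤ C) :
    ∫ ω in H, ψ (T ω, Y (T ω) ω) * Real.exp (windowDrop Y (T ω) u ω) ∂P =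
      (∫ ω in H, ψ (T ω, Y (T ω) ω) ∂P) * ∫ ω, Real.exp (windowDrop Y 0 u ω) ∂P := by
  have := hY.isProb
  have hRm : ∀ n : ℕ, Measurable fun ω => roundUp n (T ω) := fun n => (measurable_roundUp n).comp hT
  have hYlim : ∀ ω, Tendsto (fun n => Y (roundUp n (T ω)) ω) atTop (𝓝 (Y (T ω) ω)) := fun ω =>
    ((hY.path ω).rightCont (T ω)).tendsto.comp (tendsto_roundUp_nhdsGE (T ω))
  have hψlim : ∀ ω, Tendsto (fun n => ψ (roundUp n (T ω), Y (roundUp n (T ω)) ω)) atTop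
      (𝓝 (ψ (T ω, Y (T ω) ω))) := fun ω =>
    (hψ.tendsto _).comp ((tendsto_roundUp (T ω)).prodMk_nhds (hYlim ω))
  have hψm : ∀ n : ℕ, Measurable fun ω => ψ (roundUp n (T ω), Y (roundUp n (T ω)) ω) := fun n =>
    hψ.measurable.comp ((hRm n).prodMk (hY.measurable_stopped (hRm n)))
  have hDlim : ∀ ω, Tendsto (fun n => windowDrop Y (roundUp n (T ω)) u ω) atTop
      (𝓝 (windowDrop Y (T ω) u ω)) := fun ω =>
    ((hY.path ω).tendsto_winInf (fun n => (lt_roundUp n (T ω)).le)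
      (tendsto_roundUp (T ω))).sub (hYlim ω)
  have h1 := tendsto_integral_of_dominated_convergence (μ := P.restrict H) (fun _ => C)
    (fun n => (hψm n).aestronglyMeasurable) (integrable_const C)
    (fun n => .of_forall fun ω => hC _) (.of_forall hψlim)
  have h2 := tendsto_integral_of_dominated_convergence (μ := P.restrict H) (fun _ => C)
    (fun n => ((hψm n).mul (hY.measurable_windowDrop_stopped (hRm n) u).exp).aestronglyMeasurable)
    (integrable_const C)
    (fun n => .of_forall fun ω => hY.abs_mul_exp_windowDrop_le (hC _) _ _ _)
    (.of_forall fun ω => (hψlim ω).mul ((Real.continuous_exp.tendsto _).comp (hDlim ω)))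
  exact tendsto_nhds_unique h2 ((h1.mul_const _).congr fun n =>
    (hY.setIntegral_roundUp hT h0 hopt u hψ hC n).symm)

end RegularLevy

section Exponential

variable {r : ℝ}

lemma ae_pos_expMeasure (r : ℝ) : ∀ᵐ t ∂expMeasure r, 0 < t := by
  have hac : expMeasure r ≪ volume := withDensity_absolutelyContinuous _ _
  have h1 : ∀ᵐ t ∂expMeasure r, t ≠ 0 := hac.ae_le (compl_mem_ae_iff.2 (measure_singleton _))
  have h2 : ∀ᵐ t ∂expMeasure r, 0 ≤ t := by
    rw [ae_iff]
    simp only [not_le]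
    change (volume.withDensity (exponentialPDF r)) (Iio 0) = 0
    rw [withDensity_apply _ measurableSet_Iio]
    exact lintegral_exponentialPDF_of_nonpos le_rfl
  filter_upwards [h1, h2] with t h1 h2 using lt_of_le_of_ne h2 h1.symm

lemma ae_ne_expMeasure (r c : ℝ) : ∀ᵐ t ∂expMeasure r, t ≠ c := by
  have hac : expMeasure r ≪ volume := withDensity_absolutelyContinuous _ _
  exact hac.ae_le (compl_mem_ae_iff.2 (measure_singleton _))

lemma expMeasure_eq (r : ℝ) : expMeasure r = (volume.restrict (Ioi 0)).withDensity
    fun t => ENNReal.ofReal (r * Real.exp (-(r * t))) := by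
  have h : (expMeasure r).restrict (Ioi 0) = expMeasure r :=
    Measure.restrict_eq_self_of_ae_mem (ae_pos_expMeasure r)
  rw [← h, ← restrict_withDensity measurableSet_Ioi]
  change (volume.withDensity (exponentialPDF r)).restrict (Ioi 0) = _
  rw [restrict_withDensity measurableSet_Ioi, restrict_withDensity measurableSet_Ioi]
  refine withDensity_congr_ae ?_
  filter_upwards [ae_restrict_mem measurableSet_Ioi] with t ht
  exact exponentialPDF_of_nonneg (le_of_lt ht)

lemma integral_expMeasure (hr : 0 < r) (f : ℝ → ℝ) :
    ∫ t, f t ∂expMeasure r = ∫ t in Ioi (0 : ℝ), r * Real.exp (-(r * t)) * f t := by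
  rw [expMeasure_eq, integral_withDensity_eq_integral_toReal_smul (by fun_prop) (by simp)]
  refine integral_congr_ae (.of_forall fun t => ?_)
  simp only [smul_eq_mul]
  rw [ENNReal.toReal_ofReal (mul_nonneg hr.le (Real.exp_pos _).le)]

/-- Memorylessness of the exponential law. -/
lemma expMeasure_restrict_Ioi (r : ℝ) {s : ℝ} (hs : 0 ≤ s) :
    (expMeasure r).restrict (Ioi s) =
      ENNReal.ofReal (Real.exp (-(r * s))) • (expMeasure r).map (s + ·) := by
  ext S hS
  have hm : Measurable fun t => ENNReal.ofReal (r * Real.exp (-(r * t))) := by fun_prop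
  rw [Measure.restrict_apply hS, Measure.smul_apply, Measure.map_apply (by fun_prop) hS,
    expMeasure_eq, withDensity_apply _ (hS.inter measurableSet_Ioi),
    withDensity_apply _ ((by fun_prop : Measurable (s + · : ℝ → ℝ)) hS),
    Measure.restrict_restrict (hS.inter measurableSet_Ioi),
    Measure.restrict_restrict ((by fun_prop : Measurable (s + · : ℝ → ℝ)) hS), smul_eq_mul,
    ← lintegral_const_mul _ hm, ← lintegral_indicator, ← lintegral_indicator,
    ← lintegral_add_left_eq_self _ s]
  · refine lintegral_congr fun t => ?_
    simp only [indicator, mem_inter_iff, mem_Ioi, mem_preimage, lt_add_iff_pos_right]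
    by_cases h : s + t ∈ S ∧ 0 < t
    · rw [if_pos h, if_pos ⟨h, by linarith [h.2]⟩, ← ENNReal.ofReal_mul (Real.exp_pos _).le,
        mul_left_comm, ← Real.exp_add]
      congr 4
      ring
    · rw [if_neg h, if_neg fun h' => h h'.1]
  · exact ((by fun_prop : Measurable (s + · : ℝ → ℝ)) hS).inter measurableSet_Ioi
  · exact (hS.inter measurableSet_Ioi).inter measurableSet_Ioi

lemma setIntegral_expMeasure_Ioi (r : ℝ) {s : ℝ} (hs : 0 ≤ s) (f : ℝ → ℝ) :
    ∫ t in Ioi s, f t ∂expMeasure r = Real.exp (-(r * s)) * ∫ t, f (s + t) ∂expMeasure r := by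
  rw [expMeasure_restrict_Ioi r hs, integral_smul_measure,
    (measurableEmbedding_addLeft s).integral_map, ENNReal.toReal_ofReal (Real.exp_pos _).le,
    smul_eq_mul]

end Exponential

/-- The reward `K - e^w / m` on `{w < y}`, whose expectation at the killed infimum is `v_y`. -/
def putReward (K m y w : ℝ) : ℝ := if w < y then K - Real.exp w / m else 0

section PutReward

variable {K m y : ℝ}

lemma measurable_putReward (K m y : ℝ) : Measurable (putReward K m y) :=
  Measurable.ite measurableSet_Iio (by fun_prop) measurable_const

lemma exp_div_le {w : ℝ} (hm : 0 < m) (hy : Real.exp y ≤ K * m) (hw : w ≤ y) :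
    Real.exp w / m ≤ K :=
  (div_le_iff₀ hm).2 ((Real.exp_le_exp.2 hw).trans hy)

lemma putReward_nonneg (hm : 0 < m) (hy : Real.exp y ≤ K * m) (w : ℝ) :
    0 ≤ putReward K m y w := by
  unfold putReward
  split_ifs with h
  exacts [sub_nonneg.2 (exp_div_le hm hy h.le), le_rfl]

lemma antitone_putReward (hm : 0 < m) (hy : Real.exp y ≤ K * m) : Antitone (putReward K m y) := by
  intro a b hab
  by_cases hb : b < y
  · have ha : a < y := hab.trans_lt hb
    simp only [putReward, ha, hb, if_true]
    gcongr
  · exact (if_neg hb).trans_le (putReward_nonneg hm hy a)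

lemma abs_putReward_le (hK : 0 ≤ K) (hm : 0 < m) (hy : Real.exp y ≤ K * m) (w : ℝ) :
    |putReward K m y w| ≤ K := by
  rw [abs_of_nonneg (putReward_nonneg hm hy w), putReward]
  split_ifs
  exacts [sub_le_self _ (by positivity), hK]

end PutReward

lemma RegularPath.integral_putReward_winInf {p : ℝ → ℝ} (hp : RegularPath p) (r : ℝ)
    (K m y z : ℝ) {τ : ℝ} (hτ : τ = sInf {t | 0 ≤ t ∧ p t < y - z}) :
    ∫ t, putReward K m y (z + winInf p 0 t) ∂expMeasure r =
      if ∃ t, 0 ≤ t ∧ p t < y - z then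
        Real.exp (-(r * τ)) *
          ∫ u, (K - Real.exp (z + p τ) * Real.exp (winInf p τ u - p τ) / m) ∂expMeasure r
      else 0 := by
  split_ifs with h
  · have hτ0 : 0 ≤ τ := hτ ▸ Real.sInf_nonneg fun x hx => hx.1
    have h1 : ∫ t, putReward K m y (z + winInf p 0 t) ∂expMeasure r =
        ∫ t in Ioi τ, (K - Real.exp (z + winInf p 0 t) / m) ∂expMeasure r := by
      rw [← integral_indicator measurableSet_Ioi]
      refine integral_congr_ae ?_
      filter_upwards [ae_pos_expMeasure r, ae_ne_expMeasure r τ] with t ht htτ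
      rcases htτ.lt_or_gt with hlt | hgt
      · have := RegularPath.le_winInf_zero ht.le (Or.inl (hτ ▸ hlt))
        rw [putReward, if_neg (by linarith), indicator_of_notMem (notMem_Ioi.2 hlt.le)]
      · have := (hp.winInf_zero_eq h hτ (sub_pos.2 hgt)).2
        rw [add_sub_cancel] at this
        rw [putReward, if_pos (by linarith), indicator_of_mem (mem_Ioi.2 hgt)]
    rw [h1, setIntegral_expMeasure_Ioi r hτ0]
    congr 1
    refine integral_congr_ae ?_
    filter_upwards [ae_pos_expMeasure r] with u hu
    rw [(hp.winInf_zero_eq h hτ hu).1, ← Real.exp_add, add_add_sub_cancel]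
  · refine integral_eq_zero_of_ae ?_
    filter_upwards [ae_pos_expMeasure r] with t ht
    have := RegularPath.le_winInf_zero ht.le (Or.inr h)
    exact if_neg (by linarith)

/-- The mean of `exp` of the drop `windowDrop Y 0` over an independent exponential time. -/
def meanExpDrop [MeasurableSpace Ω] (P : Measure Ω) (Y : ℝ → Ω → ℝ) (r : ℝ) : ℝ :=
  ∫ t, ∫ ω, Real.exp (windowDrop Y 0 t ω) ∂P ∂expMeasure r

lemma integral_integral_swap_of_bound {α β : Type*} [MeasurableSpace α] [MeasurableSpace β]
    {μ : Measure α} {ν : Measure β} [IsFiniteMeasure μ] [IsFiniteMeasure ν] {f : α → β → ℝ}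
    (hf : Measurable f.uncurry) {C : ℝ} (hC : ∀ a b, |f a b| ≤ C) :
    ∫ b, ∫ a, f a b ∂μ ∂ν = ∫ a, ∫ b, f a b ∂ν ∂μ :=
  (integral_integral_swap
    (Integrable.of_bound hf.aestronglyMeasurable C (.of_forall fun x => hC x.1 x.2))).symm

namespace RegularLevy

variable [m0 : MeasurableSpace Ω] {P : Measure Ω} {ℱ : Filtration ℝ m0} {Y : ℝ → Ω → ℝ}

lemma measurable_windowDrop_prod (hY : RegularLevy P ℱ Y) {T : Ω → ℝ} (hT : Measurable T) :
    Measurable fun x : Ω × ℝ => windowDrop Y (T x.1) x.2 x.1 := by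
  have h : Measurable fun x : Ω × ℝ => (x.2, x.1) := measurable_swap
  have := hY.measurable_windowDrop.comp ((hT.comp measurable_fst).prodMk h)
  exact this

lemma measurable_winInf_prod (hY : RegularLevy P ℱ Y) (a : ℝ) :
    Measurable fun x : Ω × ℝ => winInf (fun t => Y t x.1) a x.2 := by
  have h : Measurable fun x : Ω × ℝ => (x.2, x.1) := measurable_swap
  have h' : Measurable fun x : ℝ × Ω => (a, x) := measurable_prodMk_left
  have := hY.measurable_winInf.comp (h'.comp h)
  exact this

lemma measurable_integral_windowDrop (hY : RegularLevy P ℱ Y) {f : ℝ → ℝ} (hf : Measurable f) :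
    Measurable fun t => ∫ ω, f (windowDrop Y 0 t ω) ∂P := by
  have := hY.isProb
  have h : Measurable fun x : Ω × ℝ => f (windowDrop Y 0 x.2 x.1) :=
    hf.comp (hY.measurable_windowDrop_prod (T := fun _ => 0) measurable_const)
  exact h.stronglyMeasurable.integral_prod_left'.measurable

lemma measurableSet_hit_lt (hY : RegularLevy P ℱ Y) (c q : ℝ) :
    MeasurableSet[ℱ q] ({ω | ∃ t, 0 ≤ t ∧ Y t ω < c} ∩
      {ω | sInf {t | 0 ≤ t ∧ Y t ω < c} < q}) := by
  have : {ω | ∃ t, 0 ≤ t ∧ Y t ω < c} ∩ {ω | sInf {t | 0 ≤ t ∧ Y t ω < c} < q} =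
      ⋃ s : ℚ, ⋃ (_ : 0 ≤ (s : ℝ)), ⋃ (_ : (s : ℝ) < q), {ω | Y s ω < c} := by
    ext ω
    simp only [mem_inter_iff, mem_ofPred_eq, mem_iUnion, exists_prop]
    rw [← (hY.path ω).exists_Ico_lt_iff]
    constructor
    · rintro ⟨h, hlt⟩
      obtain ⟨v, hv, hvq⟩ := (csInf_lt_iff ⟨0, fun x hx => hx.1⟩ h).1 hlt
      exact ⟨v, hv.1, hvq, hv.2⟩
    · rintro ⟨v, hv0, hvq, hvc⟩
      exact ⟨⟨v, hv0, hvc⟩, (csInf_le ⟨0, fun x hx => hx.1⟩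
        (show v ∈ {t | 0 ≤ t ∧ Y t ω < c} from ⟨hv0, hvc⟩)).trans_lt hvq⟩
  rw [this]
  exact .iUnion fun s => .iUnion fun hs => .iUnion fun hsq =>
    ℱ.mono hsq.le _ (measurableSet_lt (hY.adapted s hs) measurable_const)

lemma measurableSet_hit (hY : RegularLevy P ℱ Y) (c : ℝ) :
    MeasurableSet {ω | ∃ t, 0 ≤ t ∧ Y t ω < c} := by
  have : {ω | ∃ t, 0 ≤ t ∧ Y t ω < c} = ⋃ n : ℕ, {ω | ∃ t, 0 ≤ t ∧ Y t ω < c} ∩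
      {ω | sInf {t | 0 ≤ t ∧ Y t ω < c} < n} := by
    rw [← inter_iUnion]
    refine (inter_eq_left.2 fun ω _ => ?_).symm
    obtain ⟨n, hn⟩ := exists_nat_gt (sInf {t | 0 ≤ t ∧ Y t ω < c})
    exact mem_iUnion.2 ⟨n, hn⟩
  rw [this]
  exact .iUnion fun n => ℱ.le _ _ (hY.measurableSet_hit_lt c n)

lemma measurable_hittingTime (hY : RegularLevy P ℱ Y) (c : ℝ) :
    Measurable fun ω => sInf {t | 0 ≤ t ∧ Y t ω < c} := by
  refine measurable_of_Iio fun q => ?_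
  rcases le_or_gt q 0 with hq | hq
  · convert MeasurableSet.empty
    ext ω
    simpa using hq.trans (Real.sInf_nonneg fun x (hx : x ∈ {t | 0 ≤ t ∧ Y t ω < c}) => hx.1)
  · have : (fun ω => sInf {t | 0 ≤ t ∧ Y t ω < c}) ⁻¹' Iio q =
        ({ω | ∃ t, 0 ≤ t ∧ Y t ω < c} ∩ {ω | sInf {t | 0 ≤ t ∧ Y t ω < c} < q}) ∪
          {ω | ∃ t, 0 ≤ t ∧ Y t ω < c}ᶜ := by
      ext ω
      by_cases h : ∃ t, 0 ≤ t ∧ Y t ω < c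
      · simp only [mem_preimage, mem_Iio, mem_union, mem_inter_iff, mem_ofPred_eq, mem_compl_iff, h,
          true_and, not_true, or_false]
      · have he : {t | 0 ≤ t ∧ Y t ω < c} = ∅ := eq_empty_of_forall_notMem fun t ht => h ⟨t, ht⟩
        simp only [mem_preimage, mem_Iio, mem_union, mem_inter_iff, mem_ofPred_eq, mem_compl_iff, h,
          he, Real.sInf_empty, hq, false_and, not_false_iff, or_true]
    rw [this]
    exact (ℱ.le _ _ (hY.measurableSet_hit_lt c q)).union (hY.measurableSet_hit c).compl

/-- The expected discounted put payoff at the first passage time below `y`, as the expectation of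
`putReward` at the infimum of the path up to an independent exponential time. -/
lemma integral_put_hittingTime (hY : RegularLevy P ℱ Y) {r : ℝ} (hr : 0 < r) {K y : ℝ}
    (hK : 0 ≤ K) (hm : 0 < meanExpDrop P Y r) (hy : Real.exp y ≤ K * meanExpDrop P Y r) (z : ℝ)
    {H : Set Ω} (hH : H = {ω | ∃ t, 0 ≤ t ∧ Y t ω < y - z}) {τ : Ω → ℝ}
    (hτ : τ = fun ω => sInf {t | 0 ≤ t ∧ Y t ω < y - z}) :
    ∫ ω in H, Real.exp (-(r * τ ω)) * (K - Real.exp (z + Y (τ ω) ω)) ∂P =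
      ∫ t, ∫ ω, putReward K (meanExpDrop P Y r) y (z + windowDrop Y 0 t ω) ∂P ∂expMeasure r := by
  have := hY.isProb
  have := isProbabilityMeasure_expMeasure hr
  set m := meanExpDrop P Y r with hmdef
  have hHm : MeasurableSet H := hH ▸ hY.measurableSet_hit _
  have mem_hit : ∀ {ω}, ω ∈ H ↔ ∃ t, 0 ≤ t ∧ Y t ω < y - z := fun {ω} => by rw [hH]; rfl
  have hτm : Measurable τ := hτ ▸ hY.measurable_hittingTime _
  have hτ0 : ∀ ω, 0 ≤ τ ω := fun ω => hτ ▸ Real.sInf_nonneg fun x hx => hx.1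
  have hopt : ∀ q, 0 ≤ q → MeasurableSet[ℱ q] (H ∩ {ω | τ ω < q}) := fun q _ => by
    rw [hH, hτ]; exact hY.measurableSet_hit_lt _ q
  have hle : ∀ ω ∈ H, z + Y (τ ω) ω ≤ y := fun ω hω => by
    rw [hH] at hω
    have := (hY.path ω).apply_sInf_le hω
    rw [hτ]
    linarith
  set E : Ω → ℝ := fun ω => Real.exp (-(r * τ ω)) with hE
  set ψ : ℝ × ℝ → ℝ := fun x => Real.exp (-(r * |x.1|)) * min (Real.exp (z + x.2)) (Real.exp y)
    with hψdef
  have hψ : Continuous ψ := by fun_prop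
  have hψC : ∀ x, |ψ x| ≤ Real.exp y := fun x => by
    rw [abs_of_pos (mul_pos (Real.exp_pos _) (lt_min (Real.exp_pos _) (Real.exp_pos _)))]
    exact (mul_le_of_le_one_left (lt_min (Real.exp_pos _) (Real.exp_pos _)).le
      (Real.exp_le_one_iff.2 (neg_nonpos.2 (by positivity)))).trans (min_le_right _ _)
  have hψH : ∀ ω ∈ H, ψ (τ ω, Y (τ ω) ω) = E ω * Real.exp (z + Y (τ ω) ω) := fun ω hω => by
    simp only [hψdef, hE, abs_of_nonneg (hτ0 ω), min_eq_left (Real.exp_le_exp.2 (hle ω hω))]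
  have hEm : Measurable E := by fun_prop
  have hE1 : ∀ ω, |E ω| ≤ 1 := fun ω => by
    rw [Real.abs_exp]
    exact Real.exp_le_one_iff.2 (neg_nonpos.2 (mul_nonneg hr.le (hτ0 ω)))
  have hΨm : Measurable fun ω => ψ (τ ω, Y (τ ω) ω) :=
    hψ.measurable.comp (hτm.prodMk (hY.measurable_stopped hτm))
  have hEint : Integrable E (P.restrict H) :=
    Integrable.of_bound hEm.aestronglyMeasurable 1 (.of_forall hE1)
  have hΨint : Integrable (fun ω => ψ (τ ω, Y (τ ω) ω)) (P.restrict H) :=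
    Integrable.of_bound hΨm.aestronglyMeasurable (Real.exp y) (.of_forall fun ω => hψC _)
  have hDint : ∀ u, Integrable (fun ω => ψ (τ ω, Y (τ ω) ω) * Real.exp (windowDrop Y (τ ω) u ω))
      (P.restrict H) := fun u =>
    Integrable.of_bound (hΨm.mul (hY.measurable_windowDrop_stopped hτm u).exp).aestronglyMeasurable
      (Real.exp y) (.of_forall fun ω => hY.abs_mul_exp_windowDrop_le (hψC _) _ _ _)
  have hleft : ∫ ω in H, E ω * (K - Real.exp (z + Y (τ ω) ω)) ∂P =
      (∫ ω in H, E ω ∂P) * K - ∫ ω in H, ψ (τ ω, Y (τ ω) ω) ∂P := by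
    rw [← integral_mul_const, ← integral_sub (hEint.mul_const K) hΨint]
    exact setIntegral_congr_fun hHm fun ω hω => by simp only [hψH ω hω, mul_sub]
  have hright : ∫ t, ∫ ω, putReward K m y (z + windowDrop Y 0 t ω) ∂P ∂expMeasure r =
      ∫ u, ∫ ω in H, (E ω * K - ψ (τ ω, Y (τ ω) ω) * Real.exp (windowDrop Y (τ ω) u ω) / m) ∂P
        ∂expMeasure r := by
    have h0 : ∀ t, ∫ ω, putReward K m y (z + windowDrop Y 0 t ω) ∂P =
        ∫ ω, putReward K m y (z + winInf (fun s => Y s ω) 0 t) ∂P := fun t =>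
      integral_congr_ae (hY.zero.mono fun ω hω => by simp only [windowDrop, hω, sub_zero])
    simp only [h0]
    rw [integral_integral_swap_of_bound (f := fun ω t => putReward K m y (z + winInf (Y · ω) 0 t))
        ((measurable_putReward K m y).comp ((hY.measurable_winInf_prod 0).const_add z))
        (fun _ _ => abs_putReward_le hK hm hy _),
      integral_integral_swap_of_bound (f := fun ω u =>
        E ω * K - ψ (τ ω, Y (τ ω) ω) * Real.exp (windowDrop Y (τ ω) u ω) / m)
        (C := K + Real.exp y / m)
        (((hEm.comp measurable_fst).mul_const K).sub (((hΨm.comp measurable_fst).mul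
          (hY.measurable_windowDrop_prod hτm).exp).div_const m)) ?_, ← integral_indicator hHm]
    · refine integral_congr_ae (.of_forall fun ω => ?_)
      simp only
      rw [(hY.path ω).integral_putReward_winInf r K m y z (τ := τ ω) (by rw [hτ])]
      by_cases hω : ω ∈ H
      · rw [indicator_of_mem hω, if_pos (mem_hit.1 hω), ← integral_const_mul, hψH ω hω]
        refine integral_congr_ae (.of_forall fun u => ?_)
        simp only [windowDrop, hE]
        ring
      · rw [indicator_of_notMem hω, if_neg (mt mem_hit.2 hω)]
    · intro ω u
      refine (abs_sub _ _).trans (add_le_add ?_ ?_)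
      · rw [abs_mul, abs_of_nonneg hK]
        exact mul_le_of_le_one_left hK (hE1 ω)
      · rw [abs_div, abs_of_pos hm]
        exact div_le_div_of_nonneg_right (hY.abs_mul_exp_windowDrop_le (hψC _) _ _ _) hm.le
  rw [hleft, hright]
  have h3 : ∀ u,
      ∫ ω in H, (E ω * K - ψ (τ ω, Y (τ ω) ω) * Real.exp (windowDrop Y (τ ω) u ω) / m) ∂P =
      (∫ ω in H, E ω ∂P) * K -
        (∫ ω in H, ψ (τ ω, Y (τ ω) ω) ∂P) / m * ∫ ω, Real.exp (windowDrop Y 0 u ω) ∂P := fun u => by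
    rw [integral_sub (hEint.mul_const K) ((hDint u).div_const m), integral_mul_const,
      integral_div, hY.setIntegral_strongMarkov hτm (fun ω _ => hτ0 ω) hopt u hψ hψC]
    ring
  simp only [h3]
  have h4 : Integrable (fun u => ∫ ω, Real.exp (windowDrop Y 0 u ω) ∂P) (expMeasure r) := by
    refine Integrable.of_bound (hY.measurable_integral_windowDrop
      Real.measurable_exp).aestronglyMeasurable 1 (.of_forall fun u => ?_)
    refine (norm_integral_le_of_norm_le_const (C := 1) (.of_forall fun ω => ?_)).trans (by simp)
    rw [Real.norm_eq_abs, Real.abs_exp]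
    exact Real.exp_le_one_iff.2 (hY.windowDrop_nonpos 0 u ω)
  rw [integral_sub (integrable_const _) (h4.const_mul _), integral_const, integral_const_mul,
    probReal_univ, one_smul]
  change _ = _ - _ / m * m
  rw [div_mul_cancel₀ _ hm.ne']

end RegularLevy

/-- The mean of `g` at `z` plus the drop `windowDrop Y 0` over an independent exponential time. -/
def meanDrop [MeasurableSpace Ω] (P : Measure Ω) (Y : ℝ → Ω → ℝ) (r : ℝ) (g : ℝ → ℝ) (z : ℝ) : ℝ :=
  ∫ t, ∫ ω, g (z + windowDrop Y 0 t ω) ∂P ∂expMeasure r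

lemma abs_integral_le_of_forall {α : Type*} [MeasurableSpace α] {μ : Measure α}
    [IsProbabilityMeasure μ] {f : α → ℝ} {C : ℝ} (h : ∀ a, |f a| ≤ C) : |∫ a, f a ∂μ| ≤ C := by
  simpa using norm_integral_le_of_norm_le_const (μ := μ) (f := f) (.of_forall h)

namespace RegularLevy

variable [m0 : MeasurableSpace Ω] {P : Measure Ω} {ℱ : Filtration ℝ m0} {Y : ℝ → Ω → ℝ}
  {r : ℝ} {g : ℝ → ℝ} {C : ℝ}

lemma abs_meanDrop_le (hY : RegularLevy P ℱ Y) (hr : 0 < r) (hC : ∀ w, |g w| ≤ C) (z : ℝ) :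
    |meanDrop P Y r g z| ≤ C := by
  have := hY.isProb
  have := isProbabilityMeasure_expMeasure hr
  exact abs_integral_le_of_forall fun t => abs_integral_le_of_forall fun ω => hC _

lemma antitone_meanDrop (hY : RegularLevy P ℱ Y) (hr : 0 < r) (hga : Antitone g)
    (hC : ∀ w, |g w| ≤ C) : Antitone (meanDrop P Y r g) := by
  have := hY.isProb
  have := isProbabilityMeasure_expMeasure hr
  have hi : ∀ z t, Integrable (fun ω => g (z + windowDrop Y 0 t ω)) P := fun z t =>
    Integrable.of_bound (hga.measurable.comp
      ((hY.measurable_windowDrop_apply 0 t).const_add z)).aestronglyMeasurable C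
      (.of_forall fun ω => hC _)
  have hi' : ∀ z, Integrable (fun t => ∫ ω, g (z + windowDrop Y 0 t ω) ∂P) (expMeasure r) :=
    fun z => Integrable.of_bound (hY.measurable_integral_windowDrop
      (hga.measurable.comp (measurable_const_add z))).aestronglyMeasurable C 
        (.of_forall fun t => abs_integral_le_of_forall fun ω => hC _)
  intro a b hab
  exact integral_mono (hi' b) (hi' a) fun t => integral_mono (hi b t) (hi a t) fun ω =>
    hga (add_le_add_left hab _)

lemma setIntegral_meanDrop (hY : RegularLevy P ℱ Y) (hr : 0 < r) (hg : Measurable g)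
    (hC : ∀ w, |g w| ≤ C) (x : ℝ) {a : ℝ} (ha : 0 ≤ a) {A : Set Ω} (hA : MeasurableSet[ℱ a] A) :
    ∫ ω in A, meanDrop P Y r g (x + Y a ω) ∂P =
      ∫ u, ∫ ω in A, g (x + winInf (fun t => Y t ω) a u) ∂P ∂expMeasure r := by
  have := hY.isProb
  have := isProbabilityMeasure_expMeasure hr
  have h1 : ∀ u, ∫ ω in A, g (x + winInf (fun t => Y t ω) a u) ∂P =
      ∫ ω in A, ∫ ω', g (x + Y a ω + windowDrop Y 0 u ω') ∂P ∂P := fun u => by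
    rw [← hY.setIntegral_markov ha u hA (f := fun p => g (x + p.1 + p.2)) (by fun_prop)
      fun _ => hC _]
    simp only [windowDrop, add_assoc, add_sub_cancel]
  simp only [h1]
  rw [integral_integral_swap_of_bound
    (f := fun ω u => ∫ ω', g (x + Y a ω + windowDrop Y 0 u ω') ∂P) (C := C) ?_ fun ω u =>
      abs_integral_le_of_forall fun ω' => hC _]
  · rfl
  · have h2 : Measurable fun p : Ω × ℝ × ℝ => windowDrop Y 0 p.2.2 p.1 := by
      have h := hY.measurable_windowDrop_prod (T := fun _ => 0) measurable_const
      have h' : Measurable fun p : Ω × ℝ × ℝ => (p.1, p.2.2) :=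
        measurable_fst.prodMk measurable_snd.snd
      have := h.comp h'
      exact this
    have h3 : Measurable fun p : Ω × ℝ × ℝ => g (x + p.2.1 + windowDrop Y 0 p.2.2 p.1) :=
      hg.comp ((measurable_snd.fst.const_add x).add h2)
    have h4 : Measurable fun p : ℝ × ℝ => ∫ ω', g (x + p.1 + windowDrop Y 0 p.2 ω') ∂P :=
      h3.stronglyMeasurable.integral_prod_left'.measurable
    have h5 : Measurable fun p : Ω × ℝ => (Y a p.1, p.2) :=
      ((hY.measurable a).comp measurable_fst).prodMk measurable_snd
    exact h4.comp h5

lemma setIntegral_meanDrop_le (hY : RegularLevy P ℱ Y) (hr : 0 < r) (hg0 : ∀ w, 0 ≤ g w)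
    (hga : Antitone g) (hC : ∀ w, |g w| ≤ C) (x : ℝ) {s t : ℝ} (hs : 0 ≤ s) (hst : s ≤ t)
    {A : Set Ω} (hA : MeasurableSet[ℱ s] A) :
    ∫ ω in A, Real.exp (-(r * t)) * meanDrop P Y r g (x + Y t ω) ∂P ≤
      ∫ ω in A, Real.exp (-(r * s)) * meanDrop P Y r g (x + Y s ω) ∂P := by
  have := hY.isProb
  have := isProbabilityMeasure_expMeasure hr
  have hwm : ∀ a u, Measurable fun ω => winInf (fun t => Y t ω) a u := fun a u => by
    have h : Measurable fun ω : Ω => (ω, u) := measurable_prodMk_right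
    have := (hY.measurable_winInf_prod a).comp h
    exact this
  have hi : ∀ a u, Integrable (fun ω => g (x + winInf (fun t => Y t ω) a u)) (P.restrict A) :=
    fun a u => Integrable.of_bound (hga.measurable.comp
      ((hwm a u).const_add x)).aestronglyMeasurable C (.of_forall fun ω => hC _)
  have hm : ∀ a, Measurable fun u => ∫ ω in A, g (x + winInf (fun t => Y t ω) a u) ∂P := fun a => by
    have h : Measurable fun p : Ω × ℝ => g (x + winInf (fun t => Y t p.1) a p.2) :=
      hga.measurable.comp ((hY.measurable_winInf_prod a).const_add x)
    exact h.stronglyMeasurable.integral_prod_left'.measurable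
  have hb : ∀ a u, ‖∫ ω in A, g (x + winInf (fun t => Y t ω) a u) ∂P‖ ≤
      C * (P.restrict A).real univ := fun a u =>
    norm_integral_le_of_norm_le_const (.of_forall fun ω => hC _)
  have hi' : ∀ a, Integrable (fun u => ∫ ω in A, g (x + winInf (fun t => Y t ω) a u) ∂P)
      (expMeasure r) := fun a =>
    Integrable.of_bound (hm a).aestronglyMeasurable _ (.of_forall (hb a))
  rw [integral_const_mul, integral_const_mul, hY.setIntegral_meanDrop hr hga.measurable hC x hs hA,
    hY.setIntegral_meanDrop hr hga.measurable hC x (hs.trans hst) (ℱ.mono hst _ hA)]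
  calc Real.exp (-(r * t)) * ∫ u, ∫ ω in A, g (x + winInf (fun t => Y t ω) t u) ∂P ∂expMeasure r
      ≤ Real.exp (-(r * t)) *
          ∫ u, ∫ ω in A, g (x + winInf (fun t => Y t ω) s (t - s + u)) ∂P ∂expMeasure r := by
        refine mul_le_mul_of_nonneg_left (integral_mono_ae (hi' t) ?_ ?_) (Real.exp_pos _).le
        · exact Integrable.of_bound ((hm s).comp (measurable_const_add _)).aestronglyMeasurable _
            (.of_forall fun u => hb s _)
        · filter_upwards [ae_pos_expMeasure r] with u hu
          refine integral_mono (hi t u) (hi s _) fun ω => hga (add_le_add_right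
            ((hY.path ω).winInf_anti (Icc_subset_Icc hst ?_)) x)
          rw [abs_of_pos hu, abs_of_nonneg (by linarith)]
          linarith
    _ = Real.exp (-(r * s)) *
          ∫ u in Ioi (t - s), ∫ ω in A, g (x + winInf (fun t => Y t ω) s u) ∂P ∂expMeasure r := by
        rw [setIntegral_expMeasure_Ioi r (sub_nonneg.2 hst), ← mul_assoc, ← Real.exp_add]
        congr 3
        ring
    _ ≤ _ := mul_le_mul_of_nonneg_left (setIntegral_le_integral (hi' s)
        (.of_forall fun u => integral_nonneg fun ω => hg0 _)) (Real.exp_pos _).le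

lemma supermartOn_meanDrop (hY : RegularLevy P ℱ Y) (hr : 0 < r) (hg0 : ∀ w, 0 ≤ g w)
    (hga : Antitone g) (hC : ∀ w, |g w| ≤ C) (x : ℝ) :
    SupermartOn P ℱ fun t ω => Real.exp (-(r * t)) * meanDrop P Y r g (x + Y t ω) := by
  have := hY.isProb
  have hVm : Measurable (meanDrop P Y r g) := (hY.antitone_meanDrop hr hga hC).measurable
  have hsm : ∀ t, 0 ≤ t → StronglyMeasurable[ℱ t] fun ω =>
      Real.exp (-(r * t)) * meanDrop P Y r g (x + Y t ω) := fun t ht =>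
    ((hVm.comp ((hY.adapted t ht).const_add x)).const_mul _).stronglyMeasurable
  have hint : ∀ t, 0 ≤ t → Integrable (fun ω =>
      Real.exp (-(r * t)) * meanDrop P Y r g (x + Y t ω)) P := fun t ht =>
    (Integrable.of_bound (hVm.comp ((hY.measurable t).const_add x)).aestronglyMeasurable C
      (.of_forall fun ω => hY.abs_meanDrop_le hr hC _)).const_mul _
  refine ⟨hsm, hint, fun s t hs hst => ae_le_of_ae_le_trim (hm := ℱ.le s) ?_⟩
  refine ae_le_of_forall_setIntegral_le
    (integrable_condExp.trim (ℱ.le s) stronglyMeasurable_condExp)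
    ((hint s hs).trim (ℱ.le s) (hsm s hs)) fun A hA _ => ?_
  rw [← setIntegral_trim (ℱ.le s) stronglyMeasurable_condExp hA,
    ← setIntegral_trim (ℱ.le s) (hsm s hs) hA,
    setIntegral_condExp (ℱ.le s) (hint t (hs.trans hst)) hA]
  exact hY.setIntegral_meanDrop_le hr hg0 hga hC x hs hst hA

end RegularLevy

lemma runInf_eq_winInf (X : ℝ → Ω → ℝ) {t : ℝ} (ht : 0 ≤ t) (ω : Ω) :
    runInf X t ω = winInf (fun s => X (max s 0) ω) 0 t := by
  rw [runInf, winInf, zero_add, abs_of_nonneg ht]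
  exact congrArg sInf (image_congr fun s hs => by rw [max_eq_left hs.1])

section IsLevy

variable [m0 : MeasurableSpace Ω] {P : Measure Ω} {ℱ : Filtration ℝ m0} {X : ℝ → Ω → ℝ}

lemma IsLevy.mInf_eq (hX : IsLevy P ℱ X) {r : ℝ} (hr : 0 < r) :
    mInf P X r = meanExpDrop P (fun t => X (max t 0)) r := by
  rw [mInf, if_pos hr, meanExpDrop, integral_expMeasure hr]
  refine setIntegral_congr_fun measurableSet_Ioi fun t ht => ?_
  refine congrArg _ (integral_congr_ae (hX.zero.mono fun ω hω => ?_))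
  simp only [windowDrop, max_self, hω, sub_zero, runInf_eq_winInf X (le_of_lt ht)]

lemma RegularLevy.meanExpDrop_le_one {Y : ℝ → Ω → ℝ} (hY : RegularLevy P ℱ Y) {r : ℝ}
    (hr : 0 < r) : meanExpDrop P Y r ≤ 1 := by
  have := hY.isProb
  have := isProbabilityMeasure_expMeasure hr
  refine (le_abs_self _).trans
    (abs_integral_le_of_forall fun t => abs_integral_le_of_forall fun ω => ?_)
  rw [Real.abs_exp]
  exact Real.exp_le_one_iff.2 (hY.windowDrop_nonpos 0 t ω)

lemma IsLevy.vy_eq (hX : IsLevy P ℱ X) {r K y : ℝ} (hr : 0 < r) (hK : 0 < K)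
    (hm : 0 < mInf P X r) (hy : Real.exp y ≤ K * mInf P X r) :
    vy P X r K y = meanDrop P (fun t => X (max t 0)) r (putReward K (mInf P X r) y) := by
  have hY := hX.regularLevy
  funext z
  rw [hX.mInf_eq hr] at hm hy ⊢
  have hyK : Real.exp y ≤ K :=
    hy.trans (mul_le_of_le_one_right hK.le (hY.meanExpDrop_le_one hr))
  rw [meanDrop, ← hY.integral_put_hittingTime hr hK.le hm hy z rfl rfl, vy,
    ← integral_indicator (hY.measurableSet_hit _)]
  congr 1
  funext ω
  have hset : {t | 0 ≤ t ∧ z + X t ω < y} = {t | 0 ≤ t ∧ X (max t 0) ω < y - z} := by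
    ext t
    refine and_congr_right fun ht => ?_
    rw [max_eq_left ht, lt_sub_iff_add_lt']
  have hex : (∃ t, 0 ≤ t ∧ z + X t ω < y) ↔ ∃ t, 0 ≤ t ∧ X (max t 0) ω < y - z :=
    exists_congr fun t => Set.ext_iff.1 hset t
  have hτ0 : 0 ≤ sInf {t | 0 ≤ t ∧ X (max t 0) ω < y - z} := Real.sInf_nonneg fun x hx => hx.1
  by_cases h : ∃ t, 0 ≤ t ∧ X (max t 0) ω < y - z
  · rw [indicator_of_mem (mem_ofPred_eq ▸ h), putPayoff, stopPayoff, hitBelowE, hset,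
      if_pos (hex.2 h), if_pos ENNReal.ofReal_ne_top, ENNReal.toReal_ofReal hτ0]
    have hle := (hY.path ω).apply_sInf_le h
    simp only [max_eq_left hτ0] at hle ⊢
    rw [max_eq_left (sub_nonneg.2 ((Real.exp_le_exp.2 (by linarith)).trans hyK))]
  · rw [indicator_of_notMem (mem_ofPred_eq ▸ h), putPayoff, stopPayoff, hitBelowE,
      if_neg (mt hex.1 h), if_neg (by simp)]

end IsLevy

theorem stmt17 [m0 : MeasurableSpace Ω] (P : Measure Ω) (ℱ : Filtration ℝ m0)
    (X : ℝ → Ω → ℝ) (hX : IsLevy P ℱ X) (r K y : ℝ) (hr : 0 < r) (hK : 0 < K)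
    (hy : Real.exp y ≤ K * mInf P X r) :
    ∀ x : ℝ, SupermartOn P ℱ (fun t ω => Real.exp (-(r * t)) * vy P X r K y (x + X t ω)) := by
  have hm : 0 < mInf P X r := (mul_pos_iff_of_pos_left hK).1 ((Real.exp_pos y).trans_le hy)
  intro x
  have h := hX.regularLevy.supermartOn_meanDrop hr (putReward_nonneg hm hy)
    (antitone_putReward hm hy) (abs_putReward_le hK.le hm hy) x
  rw [← hX.vy_eq hr hK hm hy] at h
  have hXm : ∀ t : ℝ, 0 ≤ t → X (max t 0) = X t := fun t ht => by rw [max_eq_left ht]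
  refine ⟨fun t ht => ?_, fun t ht => ?_, fun s t hs hst => ?_⟩
  · simpa only [hXm t ht] using h.1 t ht
  · simpa only [hXm t ht] using h.2.1 t ht
  · simpa only [hXm s hs, hXm t (hs.trans hst)] using h.2.2 s t hs hst

end AKLevy
end
end

section
/- Let r > 0, K > 0, and y ≤ log K. For x ∈ ℝ set σ_x = inf{t ≥ 0 : x + X_t < y} and m = ∫_0^∞ r e^{−r t} E[e^{X̲_t}] dt. Then for every x ∈ ℝ, E[e^{−r σ_x} (K − e^{x + X_{σ_x}})^+ 1_{{σ_x < ∞}}] = m^{−1} ∫_0^∞ r e^{−r t} E[(K m − e^{x + X̲_t}) 1_{{−X̲_t > x − y}}] dt; that is, v_y(x) = E[(K E[e^{X̲_{e_r}}] − e^{x + X̲_{e_r}}) 1_{{−X̲_{e_r} > x − y}}] / E[e^{X̲_{e_r}}]. -/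
open MeasureTheory ProbabilityTheory Set Filter
open scoped ENNReal NNReal Classical

noncomputable section

namespace AKLevy

variable {Ω : Type*}

/-- A function on `[0, ∞)` that is right-continuous with left limits. -/
structure IsCadlag (f : ℝ → ℝ) : Prop where
  rightCont : ∀ t : ℝ, 0 ≤ t → ContinuousWithinAt f (Ici t) t
  leftLim : ∀ t : ℝ, 0 < t → ∃ l : ℝ, Tendsto f (nhdsWithin t (Iio t)) (nhds l)

/-- The infimum of `f` over the interval `[a, a + u]`. -/
def segInf (f : ℝ → ℝ) (a u : ℝ) : ℝ := sInf (f '' Icc a (a + u))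

/-- The running minimum of a sequence. -/
def runMin (b : ℕ → ℝ) : ℕ → ℝ
  | 0 => b 0
  | n + 1 => min (runMin b n) (b (n + 1))

theorem runMin_le (b : ℕ → ℝ) {k n : ℕ} (h : k ≤ n) : runMin b n ≤ b k := by
  induction n with
  | zero => obtain rfl : k = 0 := by omega
            exact le_rfl
  | succ n ih =>
    rcases Nat.lt_or_ge n k with h1 | h1
    · obtain rfl : k = n + 1 := by omega
      exact min_le_right _ _
    · exact (min_le_left _ _).trans (ih h1)

theorem exists_runMin_eq (b : ℕ → ℝ) (n : ℕ) : ∃ k ≤ n, runMin b n = b k := by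
  induction n with
  | zero => exact ⟨0, le_rfl, rfl⟩
  | succ n ih =>
    obtain ⟨k, hk, h⟩ := ih
    rcases min_choice (runMin b n) (b (n + 1)) with h1 | h1
    · exact ⟨k, by omega, by rw [runMin, h1, h]⟩
    · exact ⟨n + 1, le_rfl, by rw [runMin, h1]⟩

theorem runMin_sub_const (b : ℕ → ℝ) (c : ℝ) (n : ℕ) :
    runMin (fun k => b k - c) n = runMin b n - c := by
  induction n with
  | zero => rfl
  | succ n ih => rw [runMin, runMin, ih, min_sub_sub_right]

theorem measurable_runMin {α : Type*} [MeasurableSpace α] {b : ℕ → α → ℝ} (n : ℕ)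
    (hb : ∀ k ≤ n, Measurable (b k)) : Measurable (fun a => runMin (fun k => b k a) n) := by
  induction n with
  | zero => exact hb 0 le_rfl
  | succ n ih => exact (ih fun k hk => hb k (by omega)).min (hb _ le_rfl)

theorem IsCadlag.bddBelow {f : ℝ → ℝ} (hf : IsCadlag f) (T : ℝ) : BddBelow (f '' Icc 0 T) := by
  refine isCompact_Icc.induction_on (p := fun s => BddBelow (f '' s)) (by simp)
    (fun s t hst ht => ht.mono (image_mono hst))
    (fun s t hs ht => by rw [image_union]; exact hs.union ht) fun t ht => ?_
  have key : ∀ {l : Filter ℝ} {c : ℝ}, Tendsto f l (nhds c) → ∃ s ∈ l, BddBelow (f '' s) := by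
    intro l c h
    refine ⟨_, h (Ioi_mem_nhds (sub_one_lt c)), c - 1, ?_⟩
    rintro _ ⟨z, hz, rfl⟩
    exact le_of_lt hz
  obtain ⟨s, hs, hsb⟩ := key (hf.rightCont t ht.1)
  rcases ht.1.eq_or_lt with h0 | h0
  · exact ⟨s, nhdsWithin_mono t (fun z hz => by rw [← h0]; exact hz.1) hs, hsb⟩
  · obtain ⟨l, hl⟩ := hf.leftLim t h0
    obtain ⟨s', hs', hsb'⟩ := key hl
    refine ⟨s ∪ s', mem_nhdsWithin_of_mem_nhds ?_, by rw [image_union]; exact hsb.union hsb'⟩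
    rw [← nhdsLT_sup_nhdsGE]
    exact ⟨mem_of_superset hs' subset_union_right, mem_of_superset hs subset_union_left⟩

theorem IsCadlag.bddBelow_seg {f : ℝ → ℝ} (hf : IsCadlag f) {a : ℝ} (ha : 0 ≤ a) (u : ℝ) :
    BddBelow (f '' Icc a (a + u)) :=
  (hf.bddBelow (a + u)).mono (image_mono (Icc_subset_Icc_left ha))

theorem IsCadlag.segInf_le {f : ℝ → ℝ} (hf : IsCadlag f) {a u s : ℝ} (ha : 0 ≤ a)
    (hs : s ∈ Icc a (a + u)) : segInf f a u ≤ f s :=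
  csInf_le (hf.bddBelow_seg ha u) (mem_image_of_mem _ hs)

theorem exists_lt_segInf_add (f : ℝ → ℝ) (a : ℝ) {u ε : ℝ} (hu : 0 ≤ u) (hε : 0 < ε) :
    ∃ s ∈ Icc a (a + u), f s < segInf f a u + ε := by
  obtain ⟨_, ⟨s, hs, rfl⟩, h⟩ := exists_lt_of_csInf_lt
    (Nonempty.image f (nonempty_Icc.2 (by linarith : a ≤ a + u)))
    (lt_add_of_pos_right (sInf (f '' Icc a (a + u))) hε)
  exact ⟨s, hs, h⟩

theorem le_segInf {f : ℝ → ℝ} {a u c : ℝ} (hu : 0 ≤ u) (h : ∀ s ∈ Icc a (a + u), c ≤ f s) :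
    c ≤ segInf f a u := by
  refine le_csInf (Nonempty.image f (nonempty_Icc.2 (by linarith : a ≤ a + u))) ?_
  rintro _ ⟨s, hs, rfl⟩
  exact h s hs

/-- Minima over finer and finer grids converge to the infimum. -/
theorem IsCadlag.tendsto_runMin {f : ℝ → ℝ} (hf : IsCadlag f) {a u : ℝ} (ha : 0 ≤ a)
    (hu : 0 ≤ u) :
    Tendsto (fun N : ℕ => runMin (fun k => f (a + k * (u / (N + 1 : ℕ)))) (N + 1)) atTop
      (nhds (segInf f a u)) := by
  rcases hu.eq_or_lt with rfl | hu
  · have h (n : ℕ) : runMin (fun _ => f a) n = f a := (exists_runMin_eq _ n).choose_spec.2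
    simp [h, segInf]
  have hlow : ∀ N : ℕ,
      segInf f a u ≤ runMin (fun k => f (a + k * (u / (N + 1 : ℕ)))) (N + 1) := by
    intro N
    obtain ⟨k, hk, h⟩ := exists_runMin_eq (fun k => f (a + k * (u / (N + 1 : ℕ)))) (N + 1)
    rw [h]
    have hN : (0 : ℝ) < (N + 1 : ℕ) := by positivity
    have hk' : (k : ℝ) ≤ (N + 1 : ℕ) := by exact_mod_cast hk
    have h1 : (k : ℝ) * (u / (N + 1 : ℕ)) ≤ u := by
      rw [← mul_div_assoc, div_le_iff₀ hN]; nlinarith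
    have h2 : (0 : ℝ) ≤ (k : ℝ) * (u / (N + 1 : ℕ)) := by positivity
    exact hf.segInf_le ha ⟨by linarith, by linarith⟩
  refine tendsto_order.2 ⟨fun c hc => Eventually.of_forall fun N => hc.trans_le (hlow N),
    fun c hc => ?_⟩
  obtain ⟨s, hs, hfs⟩ := exists_lt_segInf_add f a hu.le (sub_pos.2 hc)
  rw [add_sub_cancel] at hfs
  let j : ℕ → ℕ := fun N => ⌈(s - a) * (N + 1 : ℕ) / u⌉₊
  let p : ℕ → ℝ := fun N => a + j N * (u / (N + 1 : ℕ))
  have hsa : 0 ≤ s - a := by linarith [hs.1]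
  have hp1 : ∀ N, s ≤ p N := by
    intro N
    have hN : (0 : ℝ) < (N + 1 : ℕ) := by positivity
    have h1 := Nat.le_ceil ((s - a) * (N + 1 : ℕ) / u)
    have h2 := mul_le_mul_of_nonneg_right h1 (by positivity : 0 ≤ u / (N + 1 : ℕ))
    have h3 : (s - a) * (N + 1 : ℕ) / u * (u / (N + 1 : ℕ)) = s - a := by field_simp
    simp only [p, j]; linarith
  have hp2 : ∀ N, p N ≤ s + u * (1 / ((N : ℝ) + 1)) := by
    intro N
    have hN : (0 : ℝ) < (N + 1 : ℕ) := by positivity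
    have h1 := (Nat.ceil_lt_add_one (by positivity : 0 ≤ (s - a) * (N + 1 : ℕ) / u)).le
    have h2 := mul_le_mul_of_nonneg_right h1 (by positivity : 0 ≤ u / (N + 1 : ℕ))
    have h3 : ((s - a) * (N + 1 : ℕ) / u + 1) * (u / (N + 1 : ℕ)) =
      s - a + u * (1 / ((N : ℝ) + 1)) := by push_cast; field_simp
    simp only [p, j]; linarith
  have hj : ∀ N, j N ≤ N + 1 := by
    intro N
    refine Nat.ceil_le.2 ?_
    rw [div_le_iff₀ hu, mul_comm]
    exact mul_le_mul_of_nonneg_left (by linarith [hs.2]) (by positivity)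
  have hlim : Tendsto p atTop (nhdsWithin s (Ici s)) := by
    refine tendsto_nhdsWithin_iff.2 ⟨?_, Eventually.of_forall hp1⟩
    refine tendsto_of_tendsto_of_tendsto_of_le_of_le tendsto_const_nhds ?_ hp1 hp2
    simpa using (tendsto_one_div_add_atTop_nhds_zero_nat.const_mul u).const_add s
  have h := ((hf.rightCont s (ha.trans hs.1)).tendsto.comp hlim).eventually_lt_const hfs
  filter_upwards [h] with N hN
  exact (runMin_le _ (hj N)).trans_lt hN

theorem IsCadlag.tendsto_segInf {f : ℝ → ℝ} (hf : IsCadlag f) {a u : ℝ} (ha : 0 ≤ a)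
    (hu : 0 ≤ u) {b : ℕ → ℝ} (hab : ∀ n, a ≤ b n) (hb : Tendsto b atTop (nhds a)) :
    Tendsto (fun n => segInf f (b n) u) atTop (nhds (segInf f a u)) := by
  have hba : Tendsto b atTop (nhdsWithin a (Ici a)) :=
    tendsto_nhdsWithin_iff.2 ⟨hb, Eventually.of_forall hab⟩
  refine tendsto_order.2 ⟨fun c hc => ?_, fun c hc => ?_⟩
  · obtain ⟨c', hcc', hc'⟩ := exists_between hc
    have h1 : c' < f (a + u) := hc'.trans_le (hf.segInf_le ha ⟨by linarith, le_rfl⟩)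
    have h2 := (hf.rightCont (a + u) (by linarith)).eventually_const_lt h1
    obtain ⟨d, hd, hd'⟩ := (mem_nhdsGE_iff_exists_Ico_subset).1 h2
    have h3 : ∀ᶠ n in atTop, b n < d - u := hb.eventually_lt_const (by linarith [mem_Ioi.1 hd])
    filter_upwards [h3] with n hn
    refine hcc'.trans_le (le_segInf hu fun s hs => ?_)
    rcases le_total s (a + u) with h | h
    · exact hc'.le.trans (hf.segInf_le ha ⟨(hab n).trans hs.1, h⟩)
    · exact le_of_lt (hd' ⟨h, by linarith [hs.2]⟩)
  · obtain ⟨s, hs, hfs⟩ := exists_lt_segInf_add f a hu (sub_pos.2 hc)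
    rw [add_sub_cancel] at hfs
    rcases hs.1.eq_or_lt with rfl | h
    · filter_upwards [((hf.rightCont a ha).tendsto.comp hba).eventually_lt_const hfs] with n hn
      exact (hf.segInf_le (ha.trans (hab n)) ⟨le_rfl, by linarith⟩).trans_lt hn
    · filter_upwards [hb.eventually_lt_const h] with n hn
      exact (hf.segInf_le (ha.trans (hab n)) ⟨hn.le, by linarith [hs.2, hab n]⟩).trans_lt hfs

/-- One step of the Markov chain recording the position and the running minimum of a random walk
with step law `μ`. -/
def stepOp (μ : Measure ℝ) (f : ℝ × ℝ → ℝ≥0∞) (p : ℝ × ℝ) : ℝ≥0∞ :=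
  ∫⁻ d, f (p.1 + d, min p.2 (p.1 + d)) ∂μ

theorem measurable_stepOp (μ : Measure ℝ) [SFinite μ] {f : ℝ × ℝ → ℝ≥0∞} (hf : Measurable f) :
    Measurable (stepOp μ f) := by
  have : Measurable (fun z : (ℝ × ℝ) × ℝ => f (z.1.1 + z.2, min z.1.2 (z.1.1 + z.2))) := by
    fun_prop
  exact this.lintegral_prod_right'

theorem lintegral_of_indep_comap {β : Type*} [MeasurableSpace β] {G : MeasurableSpace Ω}
    [m0 : MeasurableSpace Ω] {P : Measure Ω} [IsFiniteMeasure P] (hG : G ≤ m0) {Y : Ω → β}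
    (hY : Measurable[G] Y) {D : Ω → ℝ} (hD : Measurable D)
    (hi : Indep (MeasurableSpace.comap D inferInstance) G P) {F : β × ℝ → ℝ≥0∞}
    (hF : Measurable F) :
    ∫⁻ ω, F (Y ω, D ω) ∂P = ∫⁻ ω, ∫⁻ d, F (Y ω, d) ∂(P.map D) ∂P := by
  have hY' : Measurable Y := hY.mono hG le_rfl
  have hYD : IndepFun Y D P :=
    (IndepFun_iff_Indep Y D P).2 (indep_of_indep_of_le_right hi hY.comap_le).symm
  have h := (indepFun_iff_map_prod_eq_prod_map_map hY'.aemeasurable hD.aemeasurable).1 hYD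
  have : IsFiniteMeasure (P.map D) := Measure.isFiniteMeasure_map P D
  rw [← lintegral_map hF (hY'.prodMk hD), h, lintegral_prod _ hF.aemeasurable,
    lintegral_map hF.lintegral_prod_right' hY']

section Passage

variable {X : ℝ → Ω → ℝ} {c : ℝ} {ω : Ω}

theorem runInf_eq_segInf (X : ℝ → Ω → ℝ) (t : ℝ) (ω : Ω) :
    runInf X t ω = segInf (fun s => X s ω) 0 t := by
  simp [runInf, segInf]

theorem tauBelow_nonneg (X : ℝ → Ω → ℝ) (c : ℝ) (ω : Ω) : 0 ≤ tauBelow X c ω :=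
  Real.sInf_nonneg fun _ h => h.1

theorem tauBelow_le {t : ℝ} (ht : 0 ≤ t) (h : X t ω < c) : tauBelow X c ω ≤ t :=
  csInf_le ⟨0, fun _ h => h.1⟩ ⟨ht, h⟩

theorem le_of_lt_tauBelow {t : ℝ} (ht : 0 ≤ t) (h : t < tauBelow X c ω) : c ≤ X t ω := by
  by_contra! hc
  exact h.not_ge (tauBelow_le ht hc)

theorem exists_of_tauBelow_lt (hh : hitsBelow X c ω) {a : ℝ} (ha : tauBelow X c ω < a) :
    ∃ t, tauBelow X c ω ≤ t ∧ t < a ∧ X t ω < c := by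
  obtain ⟨t, ht, hta⟩ := exists_lt_of_csInf_lt hh ha
  exact ⟨t, tauBelow_le ht.1 ht.2, hta, ht.2⟩

theorem le_runInf_of_not_hitsBelow (hh : ¬ hitsBelow X c ω) {t : ℝ} (ht : 0 ≤ t) :
    c ≤ runInf X t ω := by
  rw [runInf_eq_segInf]
  refine le_segInf ht fun s hs => ?_
  by_contra! h
  exact hh ⟨s, hs.1, h⟩

theorem le_runInf_of_lt_tauBelow {t : ℝ} (ht : 0 ≤ t) (h : t < tauBelow X c ω) :
    c ≤ runInf X t ω := by
  rw [runInf_eq_segInf]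
  exact le_segInf ht fun s hs => le_of_lt_tauBelow hs.1 (by linarith [hs.2])

theorem hitBelowE_eq (X : ℝ → Ω → ℝ) (y x : ℝ) (ω : Ω) : hitBelowE X y x ω =
    if hitsBelow X (y - x) ω then ENNReal.ofReal (tauBelow X (y - x) ω) else ∞ := by
  simp only [hitBelowE, hitsBelow, tauBelow, lt_sub_iff_add_lt']

end Passage

section Levy

variable [m0 : MeasurableSpace Ω] {P : Measure Ω} {ℱ : Filtration ℝ m0} {X : ℝ → Ω → ℝ}

theorem IsLevy.isCadlag (hX : IsLevy P ℱ X) (ω : Ω) : IsCadlag (fun s => X s ω) :=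
  ⟨hX.rightCont ω, hX.leftLim ω⟩

theorem IsLevy.measurable_filtration (hX : IsLevy P ℱ X) {s t : ℝ} (hs : 0 ≤ s) (hst : s ≤ t) :
    Measurable[ℱ t] (X s) :=
  (hX.adapted s hs).measurable.mono (ℱ.mono hst) le_rfl

theorem IsLevy.measurable (hX : IsLevy P ℱ X) {s : ℝ} (hs : 0 ≤ s) : Measurable (X s) :=
  (hX.measurable_filtration hs le_rfl).mono (ℱ.le s) le_rfl

theorem IsLevy.lintegral_skeleton (hX : IsLevy P ℱ X) {q δ : ℝ} (hq : 0 ≤ q) (hδ : 0 ≤ δ)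
    {Z : Ω → ℝ≥0∞} (hZ : Measurable[ℱ q] Z) (n : ℕ) {f : ℝ × ℝ → ℝ≥0∞} (hf : Measurable f) :
    ∫⁻ ω, Z ω * f (X (q + n * δ) ω - X q ω,
      runMin (fun k => X (q + k * δ) ω - X q ω) n) ∂P =
    (∫⁻ ω, Z ω ∂P) * ((stepOp (P.map (X δ)))^[n] f) (0, 0) := by
  have := hX.isProb
  have hZ' : Measurable Z := hZ.mono (ℱ.le q) le_rfl
  have : IsFiniteMeasure (P.map (X δ)) := Measure.isFiniteMeasure_map P (X δ)
  induction n generalizing f with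
  | zero => simp [runMin, lintegral_mul_const _ hZ']
  | succ n ih =>
    rw [Function.iterate_succ_apply, ← ih (measurable_stepOp _ hf)]
    have hn : 0 ≤ n * δ := by positivity
    have hqn : 0 ≤ q + n * δ := by linarith
    have hq1 : q + n * δ ≤ q + (n + 1 : ℕ) * δ := by push_cast; linarith
    have hmap : P.map (fun ω => X (q + (n + 1 : ℕ) * δ) ω - X (q + n * δ) ω) = P.map (X δ) := by
      rw [hX.stationary _ _ hqn hq1]
      congr 2
      push_cast; ring
    have hXm : ∀ k ≤ n, Measurable[ℱ (q + n * δ)] (X (q + k * δ)) := fun k hk =>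
      hX.measurable_filtration (by positivity) (by gcongr)
    have hXq : Measurable[ℱ (q + n * δ)] (X q) := hX.measurable_filtration hq (by linarith)
    have hY : Measurable[ℱ (q + n * δ)] (fun ω => (Z ω, X (q + n * δ) ω - X q ω,
        runMin (fun k => X (q + k * δ) ω - X q ω) n)) :=
      (hZ.mono (ℱ.mono (by linarith)) le_rfl).prodMk
        (((hXm n le_rfl).sub hXq).prodMk
          (@measurable_runMin _ (ℱ (q + n * δ)) (fun k ω => X (q + k * δ) ω - X q ω) n
            fun k hk => (hXm k hk).sub hXq))
    have key := lintegral_of_indep_comap (ℱ.le (q + n * δ)) hY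
      ((hX.measurable (hqn.trans hq1)).sub (hX.measurable hqn))
      (hX.indepIncrements _ _ hqn hq1) (D := fun ω => X (q + (n + 1 : ℕ) * δ) ω - X (q + n * δ) ω)
      (F := fun z => z.1.1 * f (z.1.2.1 + z.2, min z.1.2.2 (z.1.2.1 + z.2))) (by fun_prop)
    rw [hmap] at key
    convert key using 3 with ω ω
    · have h : X (q + n * δ) ω - X q ω + (X (q + (n + 1 : ℕ) * δ) ω - X (q + n * δ) ω) =
        X (q + (n + 1 : ℕ) * δ) ω - X q ω := by ring
      simp only [h, runMin]
    · rw [lintegral_const_mul _ (by fun_prop)]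
      rfl

theorem IsLevy.measurable_skeleton (hX : IsLevy P ℱ X) {q δ : ℝ} (hq : 0 ≤ q) (hδ : 0 ≤ δ)
    (n : ℕ) : Measurable (fun ω => runMin (fun k => X (q + k * δ) ω - X q ω) n) :=
  measurable_runMin n fun k _ => (hX.measurable (by positivity)).sub (hX.measurable hq)

theorem IsLevy.tendsto_lintegral_skeleton (hX : IsLevy P ℱ X) {q u : ℝ} (hq : 0 ≤ q) (hu : 0 < u)
    {Z : Ω → ℝ≥0∞} (hZ : Measurable Z) (hZi : ∫⁻ ω, Z ω ∂P ≠ ∞) :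
    Tendsto (fun N : ℕ => ∫⁻ ω, Z ω * ENNReal.ofReal (Real.exp
      (runMin (fun k => X (q + k * (u / (N + 1 : ℕ))) ω - X q ω) (N + 1))) ∂P) atTop
    (nhds (∫⁻ ω, Z ω * ENNReal.ofReal
      (Real.exp (segInf (fun s => X s ω) q u - X q ω)) ∂P)) := by
  refine tendsto_lintegral_of_dominated_convergence Z (fun N => ?_) (fun N => ?_) hZi ?_
  · have := hX.measurable_skeleton hq (by positivity : 0 ≤ u / (N + 1 : ℕ)) (N + 1)
    fun_prop
  · refine Eventually.of_forall fun ω => mul_le_of_le_one_right' ?_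
    rw [ENNReal.ofReal_le_one, Real.exp_le_one_iff]
    refine (runMin_le _ (Nat.zero_le _)).trans ?_
    simp
  · refine Eventually.of_forall fun ω => ENNReal.Tendsto.const_mul ?_ (Or.inl ?_)
    · refine ENNReal.tendsto_ofReal ((Real.continuous_exp.tendsto _).comp ?_)
      simp only [runMin_sub_const]
      exact ((hX.isCadlag ω).tendsto_runMin hq hu.le).sub_const _
    · exact (ENNReal.ofReal_pos.2 (Real.exp_pos _)).ne'

theorem IsLevy.lintegral_mul_exp_segInf (hX : IsLevy P ℱ X) {q u : ℝ} (hq : 0 ≤ q) (hu : 0 < u)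
    {Z : Ω → ℝ≥0∞} (hZ : Measurable[ℱ q] Z) (hZi : ∫⁻ ω, Z ω ∂P ≠ ∞) :
    ∫⁻ ω, Z ω * ENNReal.ofReal (Real.exp (segInf (fun s => X s ω) q u - X q ω)) ∂P =
      (∫⁻ ω, Z ω ∂P) * ∫⁻ ω, ENNReal.ofReal (Real.exp (runInf X u ω)) ∂P := by
  have := hX.isProb
  have h1 := hX.tendsto_lintegral_skeleton hq hu (hZ.mono (ℱ.le q) le_rfl) hZi
  have h0 := hX.tendsto_lintegral_skeleton le_rfl hu (measurable_const (a := 1)) (by simp)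
  have hf : Measurable (fun p : ℝ × ℝ => ENNReal.ofReal (Real.exp p.2)) := by fun_prop
  have heq : ∀ N : ℕ, ∫⁻ ω, Z ω * ENNReal.ofReal (Real.exp
      (runMin (fun k => X (q + k * (u / (N + 1 : ℕ))) ω - X q ω) (N + 1))) ∂P =
      (∫⁻ ω, Z ω ∂P) * ∫⁻ ω, 1 * ENNReal.ofReal (Real.exp
      (runMin (fun k => X (0 + k * (u / (N + 1 : ℕ))) ω - X 0 ω) (N + 1))) ∂P := by
    intro N
    have hδ : 0 ≤ u / (N + 1 : ℕ) := by positivity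
    have e1 := hX.lintegral_skeleton hq hδ hZ (N + 1) hf
    have e0 := hX.lintegral_skeleton le_rfl hδ (@measurable_const _ _ _ (ℱ 0) 1) (N + 1) hf
    rw [e1, e0]
    simp
  simp only [heq] at h1
  rw [tendsto_nhds_unique h1 (ENNReal.Tendsto.const_mul h0 (Or.inr hZi))]
  congr 1
  refine lintegral_congr_ae ?_
  filter_upwards [hX.zero] with ω hω
  simp [hω, segInf, runInf]

/-- The right endpoint of the cell of the grid of mesh `1 / (n + 1)` that contains `t`. -/
def gridRight (n : ℕ) (t : ℝ) : ℝ := (⌊(n + 1 : ℕ) * t⌋₊ + 1 : ℝ) / (n + 1 : ℕ)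

theorem lt_gridRight (n : ℕ) (t : ℝ) : t < gridRight n t := by
  rw [gridRight, lt_div_iff₀ (by positivity), mul_comm]
  exact Nat.lt_floor_add_one _

theorem gridRight_le (n : ℕ) {t : ℝ} (ht : 0 ≤ t) : gridRight n t ≤ t + 1 / ((n : ℝ) + 1) := by
  have h := Nat.floor_le (by positivity : 0 ≤ (n + 1 : ℕ) * t)
  rw [gridRight, div_le_iff₀ (by positivity)]
  have : (t + 1 / ((n : ℝ) + 1)) * (n + 1 : ℕ) = (n + 1 : ℕ) * t + 1 := by
    push_cast; field_simp
  linarith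

theorem tendsto_gridRight {t : ℝ} (ht : 0 ≤ t) :
    Tendsto (fun n => gridRight n t) atTop (nhdsWithin t (Ici t)) := by
  refine tendsto_nhdsWithin_iff.2 ⟨?_, Eventually.of_forall fun n => (lt_gridRight n t).le⟩
  refine tendsto_of_tendsto_of_tendsto_of_le_of_le tendsto_const_nhds ?_
    (fun n => (lt_gridRight n t).le) (fun n => gridRight_le n ht)
  simpa using tendsto_one_div_add_atTop_nhds_zero_nat.const_add t

theorem measurable_gridRight (n : ℕ) : Measurable (gridRight n) := by
  unfold gridRight
  fun_prop

section Measurability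

variable {α : Type*} [MeasurableSpace α] {σ u : α → ℝ} {g : α → Ω}

theorem IsLevy.measurable_comp (hX : IsLevy P ℱ X) (hσ : Measurable σ) (hσ0 : ∀ a, 0 ≤ σ a)
    (hg : Measurable g) : Measurable (fun a => X (σ a) (g a)) := by
  refine measurable_of_tendsto_metrizable (f := fun n a => X (gridRight n (σ a)) (g a))
    (fun n => ?_) (tendsto_pi_nhds.2 fun a =>
      (hX.rightCont (g a) _ (hσ0 a)).tendsto.comp (tendsto_gridRight (hσ0 a)))
  have h1 : Measurable (fun p : ℕ × Ω => X ((p.1 + 1 : ℝ) / (n + 1 : ℕ)) p.2) :=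
    measurable_from_prod_countable_right fun k =>
      hX.measurable (by positivity : (0 : ℝ) ≤ ((k : ℝ) + 1) / (n + 1 : ℕ))
  have h2 : Measurable (fun a => ⌊(n + 1 : ℕ) * σ a⌋₊) :=
    Nat.measurable_floor.comp (hσ.const_mul _)
  exact h1.comp (h2.prodMk hg)

theorem IsLevy.measurable_segInf (hX : IsLevy P ℱ X) (hσ : Measurable σ) (hσ0 : ∀ a, 0 ≤ σ a)
    (hu : Measurable u) (hu0 : ∀ a, 0 ≤ u a) (hg : Measurable g) :
    Measurable (fun a => segInf (fun s => X s (g a)) (σ a) (u a)) := by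
  refine measurable_of_tendsto_metrizable
    (f := fun N a => runMin (fun k => X (σ a + k * (u a / (N + 1 : ℕ))) (g a)) (N + 1))
    (fun N => measurable_runMin _ fun k _ => ?_)
    (tendsto_pi_nhds.2 fun a => (hX.isCadlag (g a)).tendsto_runMin (hσ0 a) (hu0 a))
  refine hX.measurable_comp (by fun_prop) (fun a => ?_) hg
  have := hσ0 a
  have := hu0 a
  positivity

theorem IsLevy.measurable_runInf (hX : IsLevy P ℱ X) (hu : Measurable u) (hu0 : ∀ a, 0 ≤ u a)
    (hg : Measurable g) : Measurable (fun a => runInf X (u a) (g a)) := by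
  simp only [runInf_eq_segInf]
  exact hX.measurable_segInf measurable_const (fun _ => le_rfl) hu hu0 hg

end Measurability

section Passage

variable {c : ℝ} {ω : Ω}

theorem IsLevy.apply_tauBelow_le (hX : IsLevy P ℱ X) (hh : hitsBelow X c ω) :
    X (tauBelow X c ω) ω ≤ c := by
  by_contra! hc
  obtain ⟨d, hd, hd'⟩ := (mem_nhdsGE_iff_exists_Ico_subset).1
    ((hX.rightCont ω _ (tauBelow_nonneg X c ω)).eventually_const_lt hc)
  obtain ⟨t, h1, h2, h3⟩ := exists_of_tauBelow_lt hh (mem_Ioi.1 hd)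
  exact lt_asymm h3 (hd' ⟨h1, h2⟩)

theorem IsLevy.runInf_tauBelow_add (hX : IsLevy P ℱ X) (hh : hitsBelow X c ω) {u : ℝ}
    (hu : 0 ≤ u) :
    runInf X (tauBelow X c ω + u) ω = segInf (fun s => X s ω) (tauBelow X c ω) u := by
  have h0 := tauBelow_nonneg X c ω
  rw [runInf_eq_segInf]
  refine le_antisymm (le_segInf hu fun s hs => (hX.isCadlag ω).segInf_le le_rfl
    ⟨h0.trans hs.1, by linarith [hs.2]⟩) (le_segInf (by linarith) fun s hs => ?_)
  rcases lt_or_ge s (tauBelow X c ω) with h | h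
  · exact (((hX.isCadlag ω).segInf_le h0 ⟨le_rfl, by linarith⟩).trans
      (hX.apply_tauBelow_le hh)).trans (le_of_lt_tauBelow hs.1 h)
  · exact (hX.isCadlag ω).segInf_le h0 ⟨h, by linarith [hs.2]⟩

theorem IsLevy.runInf_lt_of_tauBelow_lt (hX : IsLevy P ℱ X) (hh : hitsBelow X c ω) {t : ℝ}
    (h : tauBelow X c ω < t) : runInf X t ω < c := by
  obtain ⟨s, h1, h2, h3⟩ := exists_of_tauBelow_lt hh h
  rw [runInf_eq_segInf]
  exact ((hX.isCadlag ω).segInf_le le_rfl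
    ⟨(tauBelow_nonneg X c ω).trans h1, by linarith⟩).trans_lt h3

theorem IsLevy.measurableSet_tauBelow_lt (hX : IsLevy P ℱ X) (c a : ℝ) :
    MeasurableSet[ℱ a] {ω | hitsBelow X c ω ∧ tauBelow X c ω < a} := by
  have : {ω | hitsBelow X c ω ∧ tauBelow X c ω < a} =
      ⋃ q : {q : ℚ // 0 ≤ (q : ℝ) ∧ (q : ℝ) < a}, {ω | X q.1 ω < c} := by
    ext ω
    simp only [mem_ofPred_eq, mem_iUnion, Subtype.exists]
    constructor
    · rintro ⟨hh, hlt⟩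
      obtain ⟨t, h1, h2, h3⟩ := exists_of_tauBelow_lt hh hlt
      have ht := (tauBelow_nonneg X c ω).trans h1
      obtain ⟨d, hd, hd'⟩ := (mem_nhdsGE_iff_exists_Ico_subset).1
        ((hX.rightCont ω _ ht).eventually_lt_const h3)
      obtain ⟨q, hq1, hq2⟩ := exists_rat_btwn (lt_min (mem_Ioi.1 hd) h2)
      exact ⟨q, ⟨ht.trans hq1.le, hq2.trans_le (min_le_right _ _)⟩,
        hd' ⟨hq1.le, hq2.trans_le (min_le_left _ _)⟩⟩
    · rintro ⟨q, ⟨h1, h2⟩, h3⟩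
      exact ⟨⟨q, h1, h3⟩, (tauBelow_le h1 h3).trans_lt h2⟩
  rw [this]
  exact MeasurableSet.iUnion fun q => (hX.measurable_filtration q.2.1 q.2.2.le) measurableSet_Iio

theorem IsLevy.measurableSet_hitsBelow (hX : IsLevy P ℱ X) (c : ℝ) :
    MeasurableSet {ω | hitsBelow X c ω} := by
  have : {ω | hitsBelow X c ω} =
      ⋃ n : ℕ, {ω | hitsBelow X c ω ∧ tauBelow X c ω < n} := by
    ext ω
    simp only [mem_ofPred_eq, mem_iUnion]
    exact ⟨fun h => (exists_nat_gt (tauBelow X c ω)).imp fun _ hn => ⟨h, hn⟩, fun ⟨_, h⟩ => h.1⟩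
  rw [this]
  exact MeasurableSet.iUnion fun n => ℱ.le _ _ (hX.measurableSet_tauBelow_lt c n)

theorem IsLevy.measurable_tauBelow (hX : IsLevy P ℱ X) (c : ℝ) : Measurable (tauBelow X c) := by
  refine measurable_of_Iio fun a => ?_
  rcases le_or_gt a 0 with ha | ha
  · convert MeasurableSet.empty
    ext ω
    simpa using ha.trans (tauBelow_nonneg X c ω)
  · convert (ℱ.le _ _ (hX.measurableSet_tauBelow_lt c a)).union
      (hX.measurableSet_hitsBelow c).compl
    ext ω
    by_cases h : hitsBelow X c ω
    · simp [h]
    · have : tauBelow X c ω = 0 := by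
        have h' : {t : ℝ | 0 ≤ t ∧ X t ω < c} = ∅ := by
          ext t
          simp only [mem_ofPred_eq, mem_empty_iff_false, iff_false]
          exact fun ht => h ⟨t, ht⟩
        rw [tauBelow, h', Real.sInf_empty]
      simp [h, this, ha]

/-- The Markov property at the discretized passage time. -/
theorem IsLevy.lintegral_gridRight (hX : IsLevy P ℱ X) (c : ℝ) {u : ℝ} (hu : 0 < u)
    {W : ℝ × ℝ → ℝ} (hW : Continuous W) {C : ℝ} (hC : ∀ p : ℝ × ℝ, 0 ≤ p.1 → W p ≤ C) (n : ℕ) :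
    ∫⁻ ω in {ω | hitsBelow X c ω},
      ENNReal.ofReal (W (gridRight n (tauBelow X c ω), X (gridRight n (tauBelow X c ω)) ω)) *
      ENNReal.ofReal (Real.exp (segInf (fun s => X s ω) (gridRight n (tauBelow X c ω)) u
        - X (gridRight n (tauBelow X c ω)) ω)) ∂P =
    (∫⁻ ω in {ω | hitsBelow X c ω},
      ENNReal.ofReal (W (gridRight n (tauBelow X c ω), X (gridRight n (tauBelow X c ω)) ω)) ∂P) *
      ∫⁻ ω, ENNReal.ofReal (Real.exp (runInf X u ω)) ∂P := by
  have := hX.isProb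
  let q : ℕ → ℝ := fun k => (k + 1 : ℝ) / (n + 1 : ℕ)
  have hq : ∀ k, 0 ≤ q k := fun k => by positivity
  let A : ℕ → Set Ω := fun k => {ω | hitsBelow X c ω ∧ ⌊(n + 1 : ℕ) * tauBelow X c ω⌋₊ = k}
  have hA : ∀ k, MeasurableSet[ℱ (q k)] (A k) := by
    intro k
    have : A k = {ω | hitsBelow X c ω ∧ tauBelow X c ω < q k} \
        {ω | hitsBelow X c ω ∧ tauBelow X c ω < (k : ℝ) / (n + 1 : ℕ)} := by
      ext ω
      have h0 := tauBelow_nonneg X c ω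
      simp only [A, q, mem_ofPred_eq, Set.mem_sdiff, lt_div_iff₀ (by positivity : (0 : ℝ) < (n + 1 : ℕ)),
        Nat.floor_eq_iff (by positivity : 0 ≤ (n + 1 : ℕ) * tauBelow X c ω), not_and, not_lt,
        mul_comm (tauBelow X c ω)]
      tauto
    rw [this]
    refine (hX.measurableSet_tauBelow_lt c _).diff
      (ℱ.mono ?_ _ (hX.measurableSet_tauBelow_lt c _))
    simp only [q]
    gcongr
    linarith
  have hA' : ∀ k, MeasurableSet (A k) := fun k => ℱ.le _ _ (hA k)
  have hU : {ω | hitsBelow X c ω} = ⋃ k, A k := by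
    ext ω
    simp [A]
  have hdisj : Pairwise (Function.onFun Disjoint A) := by
    intro i j hij
    refine Set.disjoint_left.2 fun ω hi hj => hij (hi.2.symm.trans hj.2)
  have hgrid : ∀ k, ∀ ω ∈ A k, gridRight n (tauBelow X c ω) = q k := by
    intro k ω hω
    simp only [gridRight, q, hω.2]
  rw [hU, lintegral_iUnion hA' hdisj, lintegral_iUnion hA' hdisj, ← ENNReal.tsum_mul_right]
  refine tsum_congr fun k => ?_
  have hZ : Measurable[ℱ (q k)] ((A k).indicator fun ω => ENNReal.ofReal (W (q k, X (q k) ω))) :=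
    Measurable.indicator ((hW.measurable.comp (measurable_const.prodMk
      (hX.measurable_filtration (hq k) le_rfl))).ennreal_ofReal) (hA k)
  have hZi : ∫⁻ ω, (A k).indicator (fun ω => ENNReal.ofReal (W (q k, X (q k) ω))) ω ∂P ≠ ∞ := by
    refine ne_top_of_le_ne_top (b := ∫⁻ _, ENNReal.ofReal C ∂P) (by simp) (lintegral_mono fun ω =>
      (indicator_le_self _ _ _).trans (ENNReal.ofReal_le_ofReal (hC _ (hq k))))
  have key := hX.lintegral_mul_exp_segInf (hq k) hu hZ hZi
  rw [lintegral_indicator (hA' k)] at key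
  have hW' : ∫⁻ ω in A k, ENNReal.ofReal
      (W (gridRight n (tauBelow X c ω), X (gridRight n (tauBelow X c ω)) ω)) ∂P =
      ∫⁻ ω in A k, ENNReal.ofReal (W (q k, X (q k) ω)) ∂P :=
    setLIntegral_congr_fun (hA' k) fun ω hω => by simp only [hgrid k ω hω]
  rw [hW', ← key, ← lintegral_indicator (hA' k)]
  refine lintegral_congr fun ω => ?_
  by_cases hω : ω ∈ A k
  · simp only [indicator_of_mem hω, hgrid k ω hω]
  · simp only [indicator_of_notMem hω, zero_mul]

theorem IsLevy.lintegral_exp_runInf_le_one (hX : IsLevy P ℱ X) {u : ℝ} (hu : 0 ≤ u) :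
    ∫⁻ ω, ENNReal.ofReal (Real.exp (runInf X u ω)) ∂P ≤ 1 := by
  have := hX.isProb
  calc ∫⁻ ω, ENNReal.ofReal (Real.exp (runInf X u ω)) ∂P ≤ ∫⁻ _, 1 ∂P := by
        refine lintegral_mono_ae ?_
        filter_upwards [hX.zero] with ω hω
        rw [ENNReal.ofReal_le_one, Real.exp_le_one_iff, runInf_eq_segInf]
        exact ((hX.isCadlag ω).segInf_le le_rfl ⟨le_rfl, by linarith⟩).trans hω.le
    _ = 1 := by simp

/-- The strong Markov property at the passage time, for the running infimum. -/
theorem IsLevy.lintegral_tauBelow (hX : IsLevy P ℱ X) (c : ℝ) {u : ℝ} (hu : 0 < u)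
    {W : ℝ × ℝ → ℝ} (hW : Continuous W) {C : ℝ} (hC : ∀ p : ℝ × ℝ, 0 ≤ p.1 → W p ≤ C) :
    ∫⁻ ω in {ω | hitsBelow X c ω},
      ENNReal.ofReal (W (tauBelow X c ω, X (tauBelow X c ω) ω)) *
      ENNReal.ofReal (Real.exp (segInf (fun s => X s ω) (tauBelow X c ω) u
        - X (tauBelow X c ω) ω)) ∂P =
    (∫⁻ ω in {ω | hitsBelow X c ω},
      ENNReal.ofReal (W (tauBelow X c ω, X (tauBelow X c ω) ω)) ∂P) *
      ∫⁻ ω, ENNReal.ofReal (Real.exp (runInf X u ω)) ∂P := by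
  have := hX.isProb
  let τ : ℕ → Ω → ℝ := fun n ω => gridRight n (tauBelow X c ω)
  have hτ0 : ∀ n ω, 0 ≤ τ n ω := fun n ω =>
    (tauBelow_nonneg X c ω).trans (lt_gridRight n _).le
  have hτ : ∀ n, Measurable (τ n) := fun n =>
    (measurable_gridRight n).comp (hX.measurable_tauBelow c)
  have hXτ : ∀ n, Measurable (fun ω => X (τ n ω) ω) := fun n =>
    hX.measurable_comp (hτ n) (hτ0 n) measurable_id
  have hIτ : ∀ n, Measurable (fun ω => segInf (fun s => X s ω) (τ n ω) u) := fun n =>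
    hX.measurable_segInf (hτ n) (hτ0 n) measurable_const (fun _ => hu.le) measurable_id
  have hWτ : ∀ n, Measurable (fun ω => ENNReal.ofReal (W (τ n ω, X (τ n ω) ω))) := fun n =>
    (hW.measurable.comp ((hτ n).prodMk (hXτ n))).ennreal_ofReal
  have hlimτ : ∀ ω, Tendsto (fun n => τ n ω) atTop
      (nhdsWithin (tauBelow X c ω) (Ici (tauBelow X c ω))) := fun ω =>
    tendsto_gridRight (tauBelow_nonneg X c ω)
  have hlimX : ∀ ω, Tendsto (fun n => X (τ n ω) ω) atTop (nhds (X (tauBelow X c ω) ω)) := fun ω =>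
    (hX.rightCont ω _ (tauBelow_nonneg X c ω)).tendsto.comp (hlimτ ω)
  have hlimW : ∀ ω, Tendsto (fun n => ENNReal.ofReal (W (τ n ω, X (τ n ω) ω))) atTop
      (nhds (ENNReal.ofReal (W (tauBelow X c ω, X (tauBelow X c ω) ω)))) := fun ω =>
    ENNReal.tendsto_ofReal ((hW.tendsto _).comp
      ((tendsto_nhds_of_tendsto_nhdsWithin (hlimτ ω)).prodMk_nhds (hlimX ω)))
  have hbound : ∀ n ω, ENNReal.ofReal (W (τ n ω, X (τ n ω) ω)) ≤ ENNReal.ofReal C := fun n ω =>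
    ENNReal.ofReal_le_ofReal (hC _ (hτ0 n ω))
  have hfin : ∫⁻ _ in {ω | hitsBelow X c ω}, ENNReal.ofReal C ∂P ≠ ∞ := by
    rw [setLIntegral_const]
    exact ENNReal.mul_ne_top ENNReal.ofReal_ne_top (measure_ne_top _ _)
  have h1 := tendsto_lintegral_of_dominated_convergence (μ := P.restrict {ω | hitsBelow X c ω})
    (fun _ => ENNReal.ofReal C) hWτ (fun n => Eventually.of_forall (hbound n)) hfin
    (Eventually.of_forall hlimW)
  have h2 : Tendsto (fun n => ∫⁻ ω in {ω | hitsBelow X c ω},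
      ENNReal.ofReal (W (τ n ω, X (τ n ω) ω)) *
      ENNReal.ofReal (Real.exp (segInf (fun s => X s ω) (τ n ω) u - X (τ n ω) ω)) ∂P) atTop
      (nhds (∫⁻ ω in {ω | hitsBelow X c ω},
      ENNReal.ofReal (W (tauBelow X c ω, X (tauBelow X c ω) ω)) *
      ENNReal.ofReal (Real.exp (segInf (fun s => X s ω) (tauBelow X c ω) u
        - X (tauBelow X c ω) ω)) ∂P)) := by
    refine tendsto_lintegral_of_dominated_convergence (fun _ => ENNReal.ofReal C)
      (fun n => ?_) (fun n => Eventually.of_forall fun ω => ?_) hfin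
      (Eventually.of_forall fun ω => ?_)
    · exact (hWτ n).mul (((hIτ n).sub (hXτ n)).exp.ennreal_ofReal)
    · refine (mul_le_of_le_one_right' ?_).trans (hbound n ω)
      rw [ENNReal.ofReal_le_one, Real.exp_le_one_iff, sub_nonpos]
      exact (hX.isCadlag ω).segInf_le (hτ0 n ω) ⟨le_rfl, by linarith⟩
    · refine ENNReal.Tendsto.mul (hlimW ω) (Or.inr ENNReal.ofReal_ne_top) ?_
        (Or.inr ENNReal.ofReal_ne_top)
      refine ENNReal.tendsto_ofReal ((Real.continuous_exp.tendsto _).comp ?_)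
      exact ((hX.isCadlag ω).tendsto_segInf (tauBelow_nonneg X c ω) hu.le
        (fun n => (lt_gridRight n _).le)
        (tendsto_nhds_of_tendsto_nhdsWithin (hlimτ ω))).sub (hlimX ω)
  refine tendsto_nhds_unique h2 ?_
  simp only [τ, hX.lintegral_gridRight c hu hW hC]
  exact ENNReal.Tendsto.mul_const h1
    (Or.inr (ne_top_of_le_ne_top ENNReal.one_ne_top (hX.lintegral_exp_runInf_le_one hu.le)))

end Passage

theorem IsLevy.measurable_apply_tauBelow (hX : IsLevy P ℱ X) (c : ℝ) :
    Measurable (fun ω => X (tauBelow X c ω) ω) :=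
  hX.measurable_comp (hX.measurable_tauBelow c) (tauBelow_nonneg X c) measurable_id

theorem IsLevy.setIntegral_tauBelow (hX : IsLevy P ℱ X) (c : ℝ) {u : ℝ} (hu : 0 < u)
    {W : ℝ × ℝ → ℝ} (hW : Continuous W) {C : ℝ} (hC : ∀ p : ℝ × ℝ, 0 ≤ p.1 → W p ≤ C)
    (hW0 : ∀ p, 0 ≤ W p) :
    ∫ ω in {ω | hitsBelow X c ω}, W (tauBelow X c ω, X (tauBelow X c ω) ω) *
      Real.exp (segInf (fun s => X s ω) (tauBelow X c ω) u - X (tauBelow X c ω) ω) ∂P =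
    (∫ ω in {ω | hitsBelow X c ω}, W (tauBelow X c ω, X (tauBelow X c ω) ω) ∂P) *
      ∫ ω, Real.exp (runInf X u ω) ∂P := by
  have hτ := hX.measurable_tauBelow c
  have hXτ := hX.measurable_apply_tauBelow c
  have hI : Measurable (fun ω => segInf (fun s => X s ω) (tauBelow X c ω) u) :=
    hX.measurable_segInf hτ (tauBelow_nonneg X c) measurable_const (fun _ => hu.le) measurable_id
  have hR : Measurable (fun ω => runInf X u ω) :=
    hX.measurable_runInf measurable_const (fun _ => hu.le) measurable_id
  have hWτ : Measurable (fun ω => W (tauBelow X c ω, X (tauBelow X c ω) ω)) :=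
    hW.measurable.comp (hτ.prodMk hXτ)
  have hE : Measurable (fun ω => Real.exp (segInf (fun s => X s ω) (tauBelow X c ω) u -
      X (tauBelow X c ω) ω)) := (hI.sub hXτ).exp
  rw [integral_eq_lintegral_of_nonneg_ae (Eventually.of_forall fun ω =>
      mul_nonneg (hW0 _) (Real.exp_pos _).le) (hWτ.mul hE).aestronglyMeasurable,
    integral_eq_lintegral_of_nonneg_ae (Eventually.of_forall fun ω => hW0 _)
      hWτ.aestronglyMeasurable,
    integral_eq_lintegral_of_nonneg_ae (Eventually.of_forall fun ω => (Real.exp_pos _).le)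
      hR.exp.aestronglyMeasurable, ← ENNReal.toReal_mul, ← hX.lintegral_tauBelow c hu hW hC]
  simp only [ENNReal.ofReal_mul (hW0 _)]

end Levy

section Discounting

variable [m0 : MeasurableSpace Ω] {r C : ℝ} {g : ℝ × Ω → ℝ}

theorem integrableOn_discount (hr : 0 < r) :
    IntegrableOn (fun t : ℝ => r * Real.exp (-(r * t))) (Ioi 0) := by
  have h := (integrableOn_exp_mul_Ioi (neg_lt_zero.2 hr) 0).const_mul r
  simp only [neg_mul] at h
  exact h

theorem setIntegral_discount (hr : 0 < r) :
    ∫ t in Ioi (0 : ℝ), r * Real.exp (-(r * t)) = 1 := by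
  have h := integral_exp_mul_Ioi (neg_lt_zero.2 hr) 0
  simp only [neg_mul] at h
  rw [integral_const_mul, h]
  field_simp
  simp

theorem integrable_discount_mul (μ : Measure Ω) [IsFiniteMeasure μ] (hr : 0 < r)
    (hg : Measurable g) (hC : ∀ p, |g p| ≤ C) :
    Integrable (fun p : ℝ × Ω => r * Real.exp (-(r * p.1)) * g p)
      ((volume.restrict (Ioi 0)).prod μ) := by
  refine (((integrableOn_discount hr).mul_prod (integrable_const (1 : ℝ) (μ := μ))).mul_bdd
    (c := C) hg.aestronglyMeasurable (Eventually.of_forall hC)).congr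
    (Eventually.of_forall fun p => ?_)
  simp

theorem integrable_discount_mul_integral (μ : Measure Ω) [IsFiniteMeasure μ] (hr : 0 < r)
    (hg : Measurable g) (hC : ∀ p, |g p| ≤ C) :
    IntegrableOn (fun t => r * Real.exp (-(r * t)) * ∫ ω, g (t, ω) ∂μ) (Ioi 0) := by
  have h := (integrable_discount_mul μ hr hg hC).integral_prod_left
  simp only [integral_const_mul] at h
  exact h

theorem setIntegral_discount_mul_integral_comm (μ : Measure Ω) [IsFiniteMeasure μ] (hr : 0 < r)
    (hg : Measurable g) (hC : ∀ p, |g p| ≤ C) :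
    ∫ t in Ioi (0 : ℝ), r * Real.exp (-(r * t)) * ∫ ω, g (t, ω) ∂μ =
      ∫ ω, (∫ t in Ioi (0 : ℝ), r * Real.exp (-(r * t)) * g (t, ω)) ∂μ := by
  rw [← integral_integral_swap (f := fun t ω => r * Real.exp (-(r * t)) * g (t, ω))
    (integrable_discount_mul μ hr hg hC)]
  simp only [integral_const_mul]

theorem setIntegral_Ioi_add (f : ℝ → ℝ) (a : ℝ) :
    ∫ t in Ioi a, f t = ∫ u in Ioi (0 : ℝ), f (a + u) := by
  have h := (measurePreserving_add_left volume a).setIntegral_preimage_emb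
    (measurableEmbedding_addLeft a) f (Ioi a)
  rw [← h]
  simp

end Discounting

section Levy

variable [m0 : MeasurableSpace Ω] {P : Measure Ω} {ℱ : Filtration ℝ m0} {X : ℝ → Ω → ℝ}

theorem IsLevy.integrableOn_discount_mul_exp_runInf (hX : IsLevy P ℱ X) {r : ℝ} (hr : 0 < r) :
    IntegrableOn (fun t => r * Real.exp (-(r * t)) * ∫ ω, Real.exp (runInf X t ω) ∂P)
      (Ioi 0) := by
  have := hX.isProb
  have hm : Measurable (fun p : ℝ × Ω => runInf X (max p.1 0) p.2) :=
    hX.measurable_runInf (by fun_prop) (fun _ => le_max_right _ _) measurable_snd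
  have h := integrable_discount_mul_integral (C := 1)
    (g := fun p : ℝ × Ω => Real.exp (min (runInf X (max p.1 0) p.2) 0)) P hr (by fun_prop)
    fun p => by rw [abs_of_pos (Real.exp_pos _), Real.exp_le_one_iff]; exact min_le_right _ _
  refine h.congr_fun (fun t ht => ?_) measurableSet_Ioi
  have ht : 0 ≤ t := le_of_lt ht
  simp only [max_eq_left ht]
  congr 1
  refine integral_congr_ae ?_
  filter_upwards [hX.zero] with ω hω
  rw [min_eq_left]
  rw [runInf_eq_segInf]
  exact ((hX.isCadlag ω).segInf_le le_rfl ⟨le_rfl, by linarith⟩).trans hω.le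

theorem IsLevy.integrable_exp_runInf (hX : IsLevy P ℱ X) {t : ℝ} (ht : 0 ≤ t) :
    Integrable (fun ω => Real.exp (runInf X t ω)) P := by
  have hm : Measurable (fun ω => runInf X t ω) :=
    hX.measurable_runInf measurable_const (fun _ => ht) measurable_id
  refine ⟨hm.exp.aestronglyMeasurable, ?_⟩
  rw [hasFiniteIntegral_iff_ofReal (Eventually.of_forall fun ω => (Real.exp_pos _).le)]
  exact (hX.lintegral_exp_runInf_le_one ht).trans_lt ENNReal.one_lt_top

theorem IsLevy.mInf_pos (hX : IsLevy P ℱ X) {r : ℝ} (hr : 0 < r) : 0 < mInf P X r := by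
  have := hX.isProb
  have hpos : ∀ t ∈ Ioi (0 : ℝ),
      0 < r * Real.exp (-(r * t)) * ∫ ω, Real.exp (runInf X t ω) ∂P := fun t ht =>
    mul_pos (mul_pos hr (Real.exp_pos _)) (integral_exp_pos (hX.integrable_exp_runInf (le_of_lt ht)))
  rw [mInf, if_pos hr, setIntegral_pos_iff_support_of_nonneg_ae
    ((ae_restrict_mem measurableSet_Ioi).mono fun t ht => (hpos t ht).le)
    (hX.integrableOn_discount_mul_exp_runInf hr)]
  have hs : Ioi (0 : ℝ) ⊆ Function.support
      (fun t => r * Real.exp (-(r * t)) * ∫ ω, Real.exp (runInf X t ω) ∂P) :=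
    fun t ht => (hpos t ht).ne'
  rw [inter_eq_right.2 hs]
  simp

theorem IsLevy.putPayoff_hitBelowE (hX : IsLevy P ℱ X) {r K y : ℝ} (hK : 0 < K)
    (hy : y ≤ Real.log K) (x : ℝ) :
    putPayoff X r K x (hitBelowE X y x) = {ω | hitsBelow X (y - x) ω}.indicator fun ω =>
      K * Real.exp (-(r * tauBelow X (y - x) ω)) -
      Real.exp (-(r * tauBelow X (y - x) ω)) *
        min (Real.exp (x + X (tauBelow X (y - x) ω) ω)) K := by
  ext ω
  by_cases h : hitsBelow X (y - x) ω
  · have h1 := hX.apply_tauBelow_le h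
    have h2 : Real.exp (x + X (tauBelow X (y - x) ω) ω) ≤ K := by
      rw [← Real.le_log_iff_exp_le hK]
      linarith
    rw [indicator_of_mem (show ω ∈ {ω | hitsBelow X (y - x) ω} from h), putPayoff, stopPayoff,
      hitBelowE_eq, if_pos h, if_pos ENNReal.ofReal_ne_top,
      ENNReal.toReal_ofReal (tauBelow_nonneg _ _ _), max_eq_left (sub_nonneg.2 h2), min_eq_left h2]
    ring
  · rw [indicator_of_notMem (show ω ∉ {ω | hitsBelow X (y - x) ω} from h), putPayoff, stopPayoff,
      hitBelowE_eq, if_neg h, if_neg (not_not.2 rfl)]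

theorem IsLevy.setIntegral_discount_of_hitsBelow (hX : IsLevy P ℱ X) {c : ℝ} {ω : Ω}
    (hh : hitsBelow X c ω) (r a x : ℝ) :
    ∫ t in Ioi (0 : ℝ), r * Real.exp (-(r * t)) *
      (if runInf X t ω < c then a - Real.exp (x + runInf X t ω) else 0) =
    ∫ u in Ioi (0 : ℝ), r * Real.exp (-(r * u)) * (Real.exp (-(r * tauBelow X c ω)) *
      (a - Real.exp (x + segInf (fun s => X s ω) (tauBelow X c ω) u))) := by
  have h1 : ∫ t in Ioi (0 : ℝ), r * Real.exp (-(r * t)) *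
      (if runInf X t ω < c then a - Real.exp (x + runInf X t ω) else 0) =
      ∫ t in Ioi (0 : ℝ), (Ioi (tauBelow X c ω)).indicator
        (fun t => r * Real.exp (-(r * t)) * (a - Real.exp (x + runInf X t ω))) t := by
    refine integral_congr_ae ?_
    have hne : ∀ᵐ t ∂(volume.restrict (Ioi (0 : ℝ))), t ≠ tauBelow X c ω :=
      ae_restrict_of_ae (Measure.ae_ne volume _)
    filter_upwards [hne, ae_restrict_mem measurableSet_Ioi] with t ht ht0
    rcases ht.lt_or_gt with h | h
    · rw [if_neg (le_runInf_of_lt_tauBelow (le_of_lt ht0) h).not_gt,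
        indicator_of_notMem (by simpa using h.le), mul_zero]
    · rw [if_pos (hX.runInf_lt_of_tauBelow_lt hh h), indicator_of_mem (show t ∈ Ioi (tauBelow X c ω) from h)]
  rw [h1, setIntegral_indicator measurableSet_Ioi,
    inter_eq_right.2 (Ioi_subset_Ioi (tauBelow_nonneg X c ω)), setIntegral_Ioi_add]
  refine setIntegral_congr_fun measurableSet_Ioi fun u hu => ?_
  simp only [hX.runInf_tauBelow_add hh (le_of_lt hu), mul_add, neg_add, Real.exp_add]
  ring

/-- Expectation of a discounted functional of the running infimum at an independent exponential
time, decomposed at the first passage time below `c`. -/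
theorem IsLevy.setIntegral_discount_mul_integral_runInf (hX : IsLevy P ℱ X) {r K c x : ℝ}
    (hr : 0 < r) (hK : 0 < K) (hc : Real.exp (x + c) ≤ K) (a : ℝ) :
    ∫ t in Ioi (0 : ℝ), r * Real.exp (-(r * t)) *
      (∫ ω, (if runInf X t ω < c then a - Real.exp (x + runInf X t ω) else 0) ∂P) =
    a * (∫ ω in {ω | hitsBelow X c ω}, Real.exp (-(r * tauBelow X c ω)) ∂P) -
    (∫ ω in {ω | hitsBelow X c ω}, Real.exp (-(r * tauBelow X c ω)) *
      min (Real.exp (x + X (tauBelow X c ω) ω)) K ∂P) * mInf P X r := by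
  have := hX.isProb
  have hH := hX.measurableSet_hitsBelow c
  have hτ := hX.measurable_tauBelow c
  have hXτ := hX.measurable_apply_tauBelow c
  have hτ1 : ∀ ω, Real.exp (-(r * tauBelow X c ω)) ≤ 1 := fun ω => by
    have := tauBelow_nonneg X c ω
    rw [Real.exp_le_one_iff, neg_nonpos]
    positivity
  let W : ℝ × ℝ → ℝ := fun p => Real.exp (-(r * p.1)) * min (Real.exp (x + p.2)) K
  have hW : Continuous W := by fun_prop
  have hW0 : ∀ p, 0 ≤ W p := fun p =>
    mul_nonneg (Real.exp_pos _).le (le_min (Real.exp_pos _).le hK.le)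
  have hWK : ∀ p : ℝ × ℝ, 0 ≤ p.1 → W p ≤ K := fun p hp =>
    (mul_le_of_le_one_left (le_min (Real.exp_pos _).le hK.le)
      (Real.exp_le_one_iff.2 (neg_nonpos.2 (by positivity)))).trans (min_le_right _ _)
  have hWτ : Measurable (fun ω => W (tauBelow X c ω, X (tauBelow X c ω) ω)) :=
    hW.measurable.comp (hτ.prodMk hXτ)
  let g₁ : ℝ × Ω → ℝ := fun p => if runInf X (max p.1 0) p.2 < c then
    a - Real.exp (x + runInf X (max p.1 0) p.2) else 0
  have hg₁ : Measurable g₁ := by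
    have hm : Measurable (fun p : ℝ × Ω => runInf X (max p.1 0) p.2) :=
      hX.measurable_runInf (by fun_prop) (fun _ => le_max_right _ _) measurable_snd
    exact Measurable.ite (hm measurableSet_Iio) (by fun_prop) measurable_const
  have hb₁ : ∀ p, |g₁ p| ≤ |a| + K := by
    intro p
    simp only [g₁]
    split_ifs with h
    · refine (abs_sub _ _).trans (add_le_add_right ?_ _)
      rw [abs_of_pos (Real.exp_pos _)]
      exact (Real.exp_le_exp.2 (by linarith)).trans hc
    · rw [abs_zero]; positivity
  let E : ℝ → Ω → ℝ := fun u ω =>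
    Real.exp (segInf (fun s => X s ω) (tauBelow X c ω) u - X (tauBelow X c ω) ω)
  have hE1 : ∀ u ω, 0 ≤ u → E u ω ≤ 1 := fun u ω hu => by
    rw [Real.exp_le_one_iff, sub_nonpos]
    exact (hX.isCadlag ω).segInf_le (tauBelow_nonneg X c ω) ⟨le_rfl, by linarith⟩
  have hE : Measurable (fun p : ℝ × Ω => E (max p.1 0) p.2) :=
    ((hX.measurable_segInf (hτ.comp measurable_snd) (fun p => tauBelow_nonneg X c p.2)
      (by fun_prop) (fun _ => le_max_right _ _) measurable_snd).sub
      (hXτ.comp measurable_snd)).exp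
  let g₂ : ℝ × Ω → ℝ := fun p => a * Real.exp (-(r * tauBelow X c p.2)) -
    W (tauBelow X c p.2, X (tauBelow X c p.2) p.2) * E (max p.1 0) p.2
  have hg₂ : Measurable g₂ :=
    (((hτ.comp measurable_snd).const_mul r).neg.exp.const_mul a).sub
      ((hWτ.comp measurable_snd).mul hE)
  have hb₂ : ∀ p, |g₂ p| ≤ |a| + K := by
    intro p
    refine (abs_sub _ _).trans (add_le_add ?_ ?_)
    · rw [abs_mul, abs_of_pos (Real.exp_pos _)]
      exact mul_le_of_le_one_right (abs_nonneg _) (hτ1 _)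
    · rw [abs_of_nonneg (mul_nonneg (hW0 _) (Real.exp_pos _).le)]
      exact (mul_le_of_le_one_right (hW0 _) (hE1 _ _ (le_max_right _ _))).trans
        (hWK _ (tauBelow_nonneg X c _))
  have hpath : ∀ ω, ∫ t in Ioi (0 : ℝ), r * Real.exp (-(r * t)) * g₁ (t, ω) =
      {ω | hitsBelow X c ω}.indicator
        (fun ω => ∫ u in Ioi (0 : ℝ), r * Real.exp (-(r * u)) * g₂ (u, ω)) ω := by
    intro ω
    have e1 : ∫ t in Ioi (0 : ℝ), r * Real.exp (-(r * t)) * g₁ (t, ω) =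
        ∫ t in Ioi (0 : ℝ), r * Real.exp (-(r * t)) *
          (if runInf X t ω < c then a - Real.exp (x + runInf X t ω) else 0) :=
      setIntegral_congr_fun measurableSet_Ioi fun t ht => by
        simp only [g₁, max_eq_left (le_of_lt ht : (0 : ℝ) ≤ t)]
    rw [e1]
    by_cases hh : hitsBelow X c ω
    · rw [indicator_of_mem (show ω ∈ {ω | hitsBelow X c ω} from hh),
        hX.setIntegral_discount_of_hitsBelow hh]
      refine setIntegral_congr_fun measurableSet_Ioi fun u hu => ?_
      have hm : min (Real.exp (x + X (tauBelow X c ω) ω)) K =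
          Real.exp (x + X (tauBelow X c ω) ω) :=
        min_eq_left ((Real.exp_le_exp.2 (by linarith [hX.apply_tauBelow_le hh])).trans hc)
      have he : Real.exp (x + segInf (fun s => X s ω) (tauBelow X c ω) u) =
          Real.exp (x + X (tauBelow X c ω) ω) * E u ω := by
        rw [← Real.exp_add]
        congr 1
        ring
      simp only [g₂, W, max_eq_left (le_of_lt hu : (0 : ℝ) ≤ u), hm, he]
      ring
    · rw [indicator_of_notMem (show ω ∉ {ω | hitsBelow X c ω} from hh)]
      refine setIntegral_eq_zero_of_forall_eq_zero fun t ht => ?_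
      rw [if_neg (le_runInf_of_not_hitsBelow hh (le_of_lt ht)).not_gt, mul_zero]
  have hint : ∀ u : ℝ, 0 < u → ∫ ω in {ω | hitsBelow X c ω}, g₂ (u, ω) ∂P =
      a * (∫ ω in {ω | hitsBelow X c ω}, Real.exp (-(r * tauBelow X c ω)) ∂P) -
      (∫ ω in {ω | hitsBelow X c ω}, W (tauBelow X c ω, X (tauBelow X c ω) ω) ∂P) *
        ∫ ω, Real.exp (runInf X u ω) ∂P := by
    intro u hu
    rw [← hX.setIntegral_tauBelow c hu hW hWK hW0, ← integral_const_mul]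
    simp only [g₂, max_eq_left hu.le]
    refine integral_sub ?_ ?_
    · refine Integrable.const_mul ?_ a
      refine Integrable.of_bound (hτ.const_mul r).neg.exp.aestronglyMeasurable 1
        (Eventually.of_forall fun ω => ?_)
      rw [Real.norm_eq_abs, abs_of_pos (Real.exp_pos _)]
      exact hτ1 ω
    · have hEu : Measurable (E u) := by
        have := hE.comp (measurable_prodMk_left (x := u))
        simpa only [Function.comp_def, max_eq_left hu.le] using this
      refine Integrable.of_bound (hWτ.mul hEu).aestronglyMeasurable K
        (Eventually.of_forall fun ω => ?_)
      rw [Real.norm_eq_abs, abs_of_nonneg (mul_nonneg (hW0 _) (Real.exp_pos _).le)]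
      exact (mul_le_of_le_one_right (hW0 _) (hE1 _ _ hu.le)).trans
        (hWK _ (tauBelow_nonneg X c _))
  calc _ = ∫ t in Ioi (0 : ℝ), r * Real.exp (-(r * t)) * ∫ ω, g₁ (t, ω) ∂P :=
        setIntegral_congr_fun measurableSet_Ioi fun t ht => by
          simp only [g₁, max_eq_left (le_of_lt ht : (0 : ℝ) ≤ t)]
    _ = ∫ u in Ioi (0 : ℝ), r * Real.exp (-(r * u)) *
          ∫ ω in {ω | hitsBelow X c ω}, g₂ (u, ω) ∂P := by
        rw [setIntegral_discount_mul_integral_comm P hr hg₁ hb₁,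
          setIntegral_discount_mul_integral_comm _ hr hg₂ hb₂, ← integral_indicator hH]
        exact integral_congr_ae (Eventually.of_forall hpath)
    _ = ∫ u in Ioi (0 : ℝ),
          (r * Real.exp (-(r * u)) *
            (a * ∫ ω in {ω | hitsBelow X c ω}, Real.exp (-(r * tauBelow X c ω)) ∂P) -
          (∫ ω in {ω | hitsBelow X c ω}, W (tauBelow X c ω, X (tauBelow X c ω) ω) ∂P) *
            (r * Real.exp (-(r * u)) * ∫ ω, Real.exp (runInf X u ω) ∂P)) :=
        setIntegral_congr_fun measurableSet_Ioi fun u hu => by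
          simp only [hint u hu]
          ring
    _ = _ := by
        rw [integral_sub ((integrableOn_discount hr).mul_const _)
          ((hX.integrableOn_discount_mul_exp_runInf hr).const_mul _), integral_mul_const,
          setIntegral_discount hr, one_mul, integral_const_mul, mInf, if_pos hr]

end Levy

theorem stmt18 [m0 : MeasurableSpace Ω] (P : Measure Ω) (ℱ : Filtration ℝ m0)
    (X : ℝ → Ω → ℝ) (hX : IsLevy P ℱ X) (r K y : ℝ) (hr : 0 < r) (hK : 0 < K)
    (hy : y ≤ Real.log K) :
    ∀ x : ℝ, vy P X r K y x =
      (∫ t in Set.Ioi (0 : ℝ), r * Real.exp (-(r * t)) *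
        (∫ ω, (if runInf X t ω < y - x then
            K * mInf P X r - Real.exp (x + runInf X t ω) else 0) ∂P)) / mInf P X r := by
  intro x
  have := hX.isProb
  have hH := hX.measurableSet_hitsBelow (y - x)
  have hτ := hX.measurable_tauBelow (y - x)
  have hXτ := hX.measurable_apply_tauBelow (y - x)
  have hτ1 : ∀ ω, Real.exp (-(r * tauBelow X (y - x) ω)) ≤ 1 := fun ω => by
    have := tauBelow_nonneg X (y - x) ω
    rw [Real.exp_le_one_iff, neg_nonpos]
    positivity
  have hc : Real.exp (x + (y - x)) ≤ K := by
    rw [add_sub_cancel, ← Real.le_log_iff_exp_le hK]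
    exact hy
  rw [hX.setIntegral_discount_mul_integral_runInf hr hK hc, eq_div_iff (hX.mInf_pos hr).ne', vy,
    hX.putPayoff_hitBelowE hK hy, integral_indicator hH, integral_sub, integral_const_mul]
  · ring
  · refine Integrable.const_mul ?_ K
    refine Integrable.of_bound (hτ.const_mul r).neg.exp.aestronglyMeasurable 1
      (Eventually.of_forall fun ω => ?_)
    rw [Real.norm_eq_abs, abs_of_pos (Real.exp_pos _)]
    exact hτ1 ω
  · refine Integrable.of_bound ((hτ.const_mul r).neg.exp.mul
      ((hXτ.const_add x).exp.min measurable_const)).aestronglyMeasurable K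
      (Eventually.of_forall fun ω => ?_)
    have h0 : 0 ≤ min (Real.exp (x + X (tauBelow X (y - x) ω) ω)) K :=
      le_min (Real.exp_pos _).le hK.le
    rw [Real.norm_eq_abs, abs_of_nonneg (mul_nonneg (Real.exp_pos _).le h0)]
    exact (mul_le_of_le_one_left h0 (hτ1 ω)).trans (min_le_right _ _)

end AKLevy
end
end
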